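/- Let n ≥ 2, q ≥ 0 and p ∈ ℝ with p + q < (n+3)/(n−1). Then there exists a constant C = C(n,p,q) > 0 such that for every x₀ ∈ ℝ^n, every R > 0 and every positive classical solution u of Δu + |∇u|^q u^p = 0 on the ball B(x₀, 2R) ⊂ ℝ^n, one has sup_{B(x₀,R)} (|∇u|²/u² + |∇u|^q u^{p−1}) ≤ C / R². -/

import Mathlib

open scoped BigOperators

/-- The Euclidean Laplacian of `u : ℝⁿ → ℝ`, defined as the sum of the second
partial derivatives in the coordinate directions. -/
noncomputable def elaplacian {n : ℕ} (u : EuclideanSpace ℝ (Fin n) → ℝ)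
    (x : EuclideanSpace ℝ (Fin n)) : ℝ :=
  ∑ i : Fin n, fderiv ℝ (fun y => fderiv ℝ u y (EuclideanSpace.single i 1)) x
    (EuclideanSpace.single i 1)

open Filter Topology Metric MeasureTheory Set

section Preliminaries

variable {n : ℕ}

/-- The `i`-th partial derivative of a function on `ℝⁿ`. -/
noncomputable def pd (i : Fin n) (f : EuclideanSpace ℝ (Fin n) → ℝ)
    (x : EuclideanSpace ℝ (Fin n)) : ℝ :=
  fderiv ℝ f x (EuclideanSpace.single i 1)

theorem elaplacian_eq_sum_pd (u : EuclideanSpace ℝ (Fin n) → ℝ) (x : EuclideanSpace ℝ (Fin n)) :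
    elaplacian u x = ∑ i, pd i (pd i u) x := rfl

theorem elaplacian_eq_sum_pd_fun (u : EuclideanSpace ℝ (Fin n) → ℝ) :
    elaplacian u = fun x => ∑ i, pd i (pd i u) x := rfl

theorem gradient_apply (u : EuclideanSpace ℝ (Fin n) → ℝ) (x : EuclideanSpace ℝ (Fin n))
    (i : Fin n) : gradient u x i = pd i u x := by
  have h : inner ℝ (gradient u x) (EuclideanSpace.single i (1 : ℝ)) = pd i u x := by
    simp [gradient, pd]
  rw [← h, EuclideanSpace.inner_single_right]
  simp

theorem norm_gradient_sq (u : EuclideanSpace ℝ (Fin n) → ℝ) (x : EuclideanSpace ℝ (Fin n)) :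
    ‖gradient u x‖ ^ 2 = ∑ i, pd i u x ^ 2 := by
  rw [EuclideanSpace.norm_sq_eq]
  simp [gradient_apply]

theorem Filter.EventuallyEq.pd {f g : EuclideanSpace ℝ (Fin n) → ℝ}
    {x : EuclideanSpace ℝ (Fin n)} (h : f =ᶠ[𝓝 x] g) (i : Fin n) : pd i f =ᶠ[𝓝 x] pd i g :=
  (h.fderiv (𝕜 := ℝ)).mono fun y hy => by simp [_root_.pd, hy]

theorem Filter.EventuallyEq.elaplacian_eq {f g : EuclideanSpace ℝ (Fin n) → ℝ}
    {x : EuclideanSpace ℝ (Fin n)} (h : f =ᶠ[𝓝 x] g) : elaplacian f x = elaplacian g x :=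
  Finset.sum_congr rfl fun i _ => ((h.pd i).pd i).eq_of_nhds

theorem ContDiffAt.pd {f : EuclideanSpace ℝ (Fin n) → ℝ} {x : EuclideanSpace ℝ (Fin n)}
    {k l : ℕ} (hf : ContDiffAt ℝ l f x) (hkl : k + 1 ≤ l) (i : Fin n) :
    ContDiffAt ℝ k (pd i f) x :=
  (hf.fderiv_right (m := k) (by exact_mod_cast hkl)).clm_apply contDiffAt_const

theorem ContDiff.pd {f : EuclideanSpace ℝ (Fin n) → ℝ} {k l : ℕ} (hf : ContDiff ℝ l f)
    (hkl : k + 1 ≤ l) (i : Fin n) : ContDiff ℝ k (pd i f) :=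
  contDiff_iff_contDiffAt.2 fun _ => hf.contDiffAt.pd hkl i

theorem HasCompactSupport.pd {f : EuclideanSpace ℝ (Fin n) → ℝ} (hf : HasCompactSupport f)
    (i : Fin n) : HasCompactSupport (pd i f) :=
  hf.fderiv_apply ℝ _

theorem HasFDerivAt.pd_eq {f : EuclideanSpace ℝ (Fin n) → ℝ}
    {f' : EuclideanSpace ℝ (Fin n) →L[ℝ] ℝ} {x : EuclideanSpace ℝ (Fin n)}
    (hf : HasFDerivAt f f' x) (i : Fin n) : pd i f x = f' (EuclideanSpace.single i 1) := by
  rw [pd, hf.fderiv]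

theorem pd_add {f g : EuclideanSpace ℝ (Fin n) → ℝ} {x : EuclideanSpace ℝ (Fin n)}
    (hf : DifferentiableAt ℝ f x) (hg : DifferentiableAt ℝ g x) (i : Fin n) :
    pd i (fun y => f y + g y) x = pd i f x + pd i g x := by
  rw [(hf.hasFDerivAt.fun_add hg.hasFDerivAt).pd_eq]; rfl

theorem pd_sub {f g : EuclideanSpace ℝ (Fin n) → ℝ} {x : EuclideanSpace ℝ (Fin n)}
    (hf : DifferentiableAt ℝ f x) (hg : DifferentiableAt ℝ g x) (i : Fin n) :
    pd i (fun y => f y - g y) x = pd i f x - pd i g x := by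
  rw [(hf.hasFDerivAt.fun_sub hg.hasFDerivAt).pd_eq]; rfl

theorem pd_mul {f g : EuclideanSpace ℝ (Fin n) → ℝ} {x : EuclideanSpace ℝ (Fin n)}
    (hf : DifferentiableAt ℝ f x) (hg : DifferentiableAt ℝ g x) (i : Fin n) :
    pd i (fun y => f y * g y) x = pd i f x * g x + f x * pd i g x := by
  rw [(hf.hasFDerivAt.fun_mul hg.hasFDerivAt).pd_eq]
  simp [pd]; ring

theorem pd_const (c : ℝ) (i : Fin n) (x : EuclideanSpace ℝ (Fin n)) :
    pd i (fun _ => c) x = 0 := by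
  simp [pd]

theorem pd_const_mul {f : EuclideanSpace ℝ (Fin n) → ℝ} {x : EuclideanSpace ℝ (Fin n)}
    (c : ℝ) (hf : DifferentiableAt ℝ f x) (i : Fin n) :
    pd i (fun y => c * f y) x = c * pd i f x := by
  rw [pd_mul (differentiableAt_const c) hf, pd_const]; ring

theorem pd_sum {ι : Type*} {s : Finset ι} {f : ι → EuclideanSpace ℝ (Fin n) → ℝ}
    {x : EuclideanSpace ℝ (Fin n)} (hf : ∀ j ∈ s, DifferentiableAt ℝ (f j) x) (i : Fin n) :
    pd i (fun y => ∑ j ∈ s, f j y) x = ∑ j ∈ s, pd i (f j) x := by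
  rw [(HasFDerivAt.fun_sum fun j hj => (hf j hj).hasFDerivAt).pd_eq]
  simp [pd]

/-- Chain rule for partial derivatives of `φ ∘ f`. -/
theorem pd_comp {φ : ℝ → ℝ} {φ' : ℝ} {f : EuclideanSpace ℝ (Fin n) → ℝ}
    {x : EuclideanSpace ℝ (Fin n)} (hφ : HasDerivAt φ φ' (f x)) (hf : DifferentiableAt ℝ f x)
    (i : Fin n) : pd i (fun y => φ (f y)) x = φ' * pd i f x := by
  have h : HasFDerivAt (fun y => φ (f y)) (φ' • fderiv ℝ f x) x :=
    hφ.comp_hasFDerivAt x hf.hasFDerivAt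
  rw [h.pd_eq]
  rfl

theorem pd_pd_comm {f : EuclideanSpace ℝ (Fin n) → ℝ} {x : EuclideanSpace ℝ (Fin n)}
    (hf : ContDiffAt ℝ 2 f x) (i j : Fin n) : pd i (pd j f) x = pd j (pd i f) x := by
  have hd : DifferentiableAt ℝ (fderiv ℝ f) x :=
    (hf.fderiv_right (m := 1) (by norm_num)).differentiableAt one_ne_zero
  have key : ∀ a b : Fin n, pd a (pd b f) x =
      fderiv ℝ (fderiv ℝ f) x (EuclideanSpace.single a 1) (EuclideanSpace.single b 1) := by
    intro a b
    have h := hd.hasFDerivAt.clm_apply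
      (hasFDerivAt_const (EuclideanSpace.single b (1 : ℝ)) x)
    rw [show pd b f = fun y => fderiv ℝ f y (EuclideanSpace.single b 1) from rfl, h.pd_eq]
    simp
  rw [key, key]
  exact (hf.isSymmSndFDerivAt (by simp)) _ _

/-- At an interior local maximum the Laplacian is nonpositive. -/
theorem IsLocalMax.elaplacian_nonpos {f : EuclideanSpace ℝ (Fin n) → ℝ}
    {x : EuclideanSpace ℝ (Fin n)} (h : IsLocalMax f x) (hf : ContDiffAt ℝ 2 f x) :
    elaplacian f x ≤ 0 := by
  refine Finset.sum_nonpos fun i _ => ?_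
  change pd i (pd i f) x ≤ 0
  set e : EuclideanSpace ℝ (Fin n) := EuclideanSpace.single i 1 with he
  set ℓ : ℝ → EuclideanSpace ℝ (Fin n) := fun t => x + t • e with hℓ
  have hℓ0 : ℓ 0 = x := by simp [hℓ]
  have hℓd : ∀ t, HasDerivAt ℓ e t := fun t => by
    have h := ((hasDerivAt_id t).smul_const e).const_add x
    rwa [one_smul] at h
  have hℓc : Tendsto ℓ (𝓝 0) (𝓝 x) := by
    simpa [hℓ0] using (hℓd 0).continuousAt.tendsto
  have hev : ∀ᶠ t in 𝓝 (0 : ℝ), ContDiffAt ℝ 2 f (ℓ t) :=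
    hℓc.eventually (hf.eventually (by simp))
  have hd1 : ∀ᶠ t in 𝓝 (0 : ℝ), deriv (fun t => f (ℓ t)) t = pd i f (ℓ t) := by
    filter_upwards [hev] with t ht
    exact ((ht.differentiableAt (by norm_num)).hasFDerivAt.comp_hasDerivAt t (hℓd t)).deriv
  have hd2 : deriv (deriv fun t => f (ℓ t)) 0 = pd i (pd i f) x := by
    rw [EventuallyEq.deriv_eq hd1]
    have : DifferentiableAt ℝ (pd i f) (ℓ 0) := by
      rw [hℓ0]; exact (ContDiffAt.pd (k := 1) hf (by norm_num) i).differentiableAt (by norm_num)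
    refine (this.hasFDerivAt.comp_hasDerivAt 0 (hℓd 0)).deriv.trans ?_
    rw [hℓ0]; rfl
  have hmax : IsLocalMax (fun t => f (ℓ t)) 0 := by
    have : IsLocalMax f (ℓ 0) := by rwa [hℓ0]
    exact this.comp_continuous (hℓd 0).continuousAt
  by_contra! hpos
  rw [← hd2] at hpos
  have hmin := isLocalMin_of_deriv_deriv_pos hpos hmax.deriv_eq_zero
    (ContinuousAt.comp (f := ℓ) (by rw [hℓ0]; exact hf.continuousAt) (hℓd 0).continuousAt)
  have hconst : (fun t => f (ℓ t)) =ᶠ[𝓝 0] fun _ => f (ℓ 0) := by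
    filter_upwards [hmax, hmin] with t h1 h2 using le_antisymm h1 h2
  have h3 : deriv (fun t => f (ℓ t)) =ᶠ[𝓝 0] fun _ => 0 := by
    simpa using hconst.deriv
  rw [h3.deriv_eq] at hpos
  simp at hpos

end Preliminaries

section Mollification

open ContinuousLinearMap
open scoped Convolution

variable {n : ℕ}

/-- Mollification of `g` by the normalised bump function `φ`. -/
noncomputable def mollify (φ : ContDiffBump (0 : EuclideanSpace ℝ (Fin n)))
    (g : EuclideanSpace ℝ (Fin n) → ℝ) : EuclideanSpace ℝ (Fin n) → ℝ :=
  φ.normed volume ⋆[lsmul ℝ ℝ, volume] g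

theorem pd_mollify (φ : ContDiffBump (0 : EuclideanSpace ℝ (Fin n)))
    {g : EuclideanSpace ℝ (Fin n) → ℝ} (hg : ContDiff ℝ 1 g) (hc : HasCompactSupport g)
    (i : Fin n) : pd i (mollify φ g) = mollify φ (pd i g) := by
  have hφ : LocallyIntegrable (φ.normed volume) volume :=
    (φ.continuous_normed (μ := volume)).locallyIntegrable
  funext x
  rw [mollify, (hc.hasFDerivAt_convolution_right (lsmul ℝ ℝ) hφ hg x).pd_eq,
    convolution_precompR_apply _ hφ (hc.fderiv ℝ) (hg.continuous_fderiv one_ne_zero)]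
  rfl

theorem contDiff_mollify (φ : ContDiffBump (0 : EuclideanSpace ℝ (Fin n)))
    {g : EuclideanSpace ℝ (Fin n) → ℝ} (hg : Continuous g) (k : ℕ) :
    ContDiff ℝ k (mollify φ g) := by
  have := φ.hasCompactSupport_normed (μ := volume).contDiff_convolution_left (lsmul ℝ ℝ)
    (n := k) (μ := volume) φ.contDiff_normed hg.locallyIntegrable
  exact_mod_cast this

theorem mollify_congr (φ : ContDiffBump (0 : EuclideanSpace ℝ (Fin n)))
    {f g : EuclideanSpace ℝ (Fin n) → ℝ} {x : EuclideanSpace ℝ (Fin n)}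
    (h : ∀ y ∈ ball x φ.rOut, f y = g y) : mollify φ f x = mollify φ g x := by
  simp only [mollify, convolution_def]
  refine integral_congr_ae (Eventually.of_forall fun t => ?_)
  by_cases ht : t ∈ ball (0 : EuclideanSpace ℝ (Fin n)) φ.rOut
  · have : x - t ∈ ball x φ.rOut := by simpa [mem_ball, dist_eq_norm] using ht
    simp [h _ this]
  · rw [← φ.support_normed_eq (μ := volume), Function.notMem_support] at ht
    simp [ht]

theorem eventually_mollify_close {g : EuclideanSpace ℝ (Fin n) → ℝ} (hg : Continuous g)
    (hc : HasCompactSupport g) {δ : ℝ} (hδ : 0 < δ) :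
    ∀ᶠ r in 𝓝[>] (0 : ℝ), ∀ φ : ContDiffBump (0 : EuclideanSpace ℝ (Fin n)), φ.rOut = r →
      ∀ y, |mollify φ g y - g y| ≤ δ := by
  obtain ⟨ε, hε, h⟩ := Metric.uniformContinuous_iff.1 (hc.uniformContinuous_of_continuous hg) δ hδ
  filter_upwards [Ioo_mem_nhdsGT hε] with r hr φ hφ y
  rw [← Real.dist_eq]
  exact φ.dist_normed_convolution_le hg.aestronglyMeasurable fun x hx =>
    (h (lt_trans (by simpa [hφ] using hx) hr.2)).le

theorem sum_mollify {ι : Type*} (s : Finset ι) (φ : ContDiffBump (0 : EuclideanSpace ℝ (Fin n)))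
    {g : ι → EuclideanSpace ℝ (Fin n) → ℝ} (hg : ∀ i ∈ s, Continuous (g i))
    (x : EuclideanSpace ℝ (Fin n)) :
    ∑ i ∈ s, mollify φ (g i) x = mollify φ (fun y => ∑ i ∈ s, g i y) x := by
  simp only [mollify, convolution_def, map_sum]
  rw [integral_finsetSum]
  intro i hi
  have : Continuous fun t => φ.normed volume t * g i (x - t) :=
    (φ.continuous_normed (μ := volume)).mul ((hg i hi).comp (by fun_prop))
  exact this.integrable_of_hasCompactSupport (φ.hasCompactSupport_normed (μ := volume)).mul_right

/-- A compactly supported `C²` function whose Laplacian is `C¹` on a ball is approximated by smooth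
functions, in `C²`, with the gradient of the Laplacian converging on a smaller ball. -/
theorem exists_smooth_approx {V G : EuclideanSpace ℝ (Fin n) → ℝ} (hV : ContDiff ℝ 2 V)
    (hVc : HasCompactSupport V) (hG : ContDiff ℝ 1 G) (hGc : HasCompactSupport G)
    {x : EuclideanSpace ℝ (Fin n)} {r : ℝ} (hr : 0 < r)
    (hVG : ∀ y ∈ ball x (2 * r), elaplacian V y = G y) {δ : ℝ} (hδ : 0 < δ) :
    ∃ W : EuclideanSpace ℝ (Fin n) → ℝ, ContDiff ℝ 3 W ∧
      (∀ i y, |pd i W y - pd i V y| ≤ δ) ∧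
      (∀ i j y, |pd i (pd j W) y - pd i (pd j V) y| ≤ δ) ∧
      ∀ i, ∀ y ∈ ball x r, |pd i (elaplacian W) y - pd i G y| ≤ δ := by
  have hV1 : ∀ i, ContDiff ℝ 1 (pd i V) := fun i => ContDiff.pd (k := 1) hV (by norm_num) i
  have hV2 : ∀ i j, Continuous (pd i (pd j V)) := fun i j =>
    (ContDiff.pd (k := 0) (l := 1) (hV1 j) (by norm_num) i).continuous
  have hG1 : ∀ i, Continuous (pd i G) := fun i =>
    (ContDiff.pd (k := 0) (l := 1) hG (by norm_num) i).continuous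
  have e1 := eventually_all.2 fun i => eventually_mollify_close (hV1 i).continuous (hVc.pd i) hδ
  have e2 := eventually_all.2 fun i => eventually_all.2 fun j =>
    eventually_mollify_close (hV2 i j) ((hVc.pd j).pd i) hδ
  have e3 := eventually_all.2 fun i => eventually_mollify_close (hG1 i) (hGc.pd i) hδ
  obtain ⟨ρ, h1, h2, h3, hρ0, hρr⟩ := (e1.and (e2.and (e3.and (Ioo_mem_nhdsGT hr)))).exists
  let φ : ContDiffBump (0 : EuclideanSpace ℝ (Fin n)) := ⟨ρ / 2, ρ, by linarith, by linarith⟩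
  have p1 : ∀ i, pd i (mollify φ V) = mollify φ (pd i V) := fun i =>
    pd_mollify φ (hV.of_le (by norm_num)) hVc i
  have p2 : ∀ i j, pd i (pd j (mollify φ V)) = mollify φ (pd i (pd j V)) := fun i j => by
    rw [p1, pd_mollify φ (hV1 j) (hVc.pd j)]
  refine ⟨mollify φ V, contDiff_mollify φ hV.continuous 3, fun i y => ?_, fun i j y => ?_,
    fun i y hy => ?_⟩
  · rw [p1]; exact h1 i φ rfl y
  · rw [p2]; exact h2 i j φ rfl y
  · have hlap : elaplacian (mollify φ V) =ᶠ[𝓝 y] mollify φ G := by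
      filter_upwards [isOpen_ball.mem_nhds hy] with z hz
      rw [elaplacian_eq_sum_pd]
      simp only [p2]
      rw [sum_mollify _ _ fun i _ => hV2 i i]
      refine mollify_congr φ fun w hw => hVG w ?_
      have hw' : dist w z < ρ := hw
      have hz' : dist z x < r := hz
      exact mem_ball.2 (by linarith [dist_triangle w z x])
    rw [(hlap.pd i).eq_of_nhds, pd_mollify φ hG hGc]
    exact h3 i φ rfl y

end Mollification

section LocalMaximum

variable {n : ℕ}

theorem pd_sq {f : EuclideanSpace ℝ (Fin n) → ℝ} {x : EuclideanSpace ℝ (Fin n)}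
    (hf : DifferentiableAt ℝ f x) (i : Fin n) :
    pd i (fun y => f y ^ 2) x = 2 * f x * pd i f x := by
  simpa using pd_comp (φ := fun t => t ^ 2) (by simpa using hasDerivAt_pow 2 (f x)) hf i

theorem pd_norm_sub_sq (x₀ x : EuclideanSpace ℝ (Fin n)) (i : Fin n) :
    pd i (fun y => ‖y - x₀‖ ^ 2) x = 2 * (x i - x₀ i) := by
  have h : HasFDerivAt (fun y : EuclideanSpace ℝ (Fin n) => ‖y - x₀‖ ^ 2)
      (2 • (innerSL ℝ (x - x₀)).comp (ContinuousLinearMap.id ℝ _)) x :=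
    ((hasFDerivAt_id x).sub_const x₀).norm_sq
  rw [h.pd_eq]
  simp [EuclideanSpace.inner_single_right]

theorem pd_coord_sub (c : ℝ) (x : EuclideanSpace ℝ (Fin n)) (i j : Fin n) :
    pd i (fun y => y j - c) x = if i = j then 1 else 0 := by
  have h : HasFDerivAt (fun y : EuclideanSpace ℝ (Fin n) => y j - c)
      (EuclideanSpace.proj (𝕜 := ℝ) j) x :=
    (EuclideanSpace.proj (𝕜 := ℝ) j).hasFDerivAt.sub_const c
  rw [h.pd_eq]
  simp [eq_comm]

theorem contDiff_norm_sub_sq (x₀ : EuclideanSpace ℝ (Fin n)) (k : ℕ) :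
    ContDiff ℝ k (fun y => ‖y - x₀‖ ^ 2) :=
  (contDiff_id.sub contDiff_const).norm_sq ℝ

theorem pd_pd_norm_sub_sq (x₀ x : EuclideanSpace ℝ (Fin n)) (i : Fin n) :
    pd i (pd i (fun y => ‖y - x₀‖ ^ 2)) x = 2 := by
  rw [show pd i (fun y => ‖y - x₀‖ ^ 2) = fun y => 2 * (y i - x₀ i) from
    funext fun y => pd_norm_sub_sq x₀ y i, pd_const_mul _ (by fun_prop), pd_coord_sub]
  simp

theorem elaplacian_norm_sub_sq (x₀ x : EuclideanSpace ℝ (Fin n)) :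
    elaplacian (fun y => ‖y - x₀‖ ^ 2) x = 2 * n := by
  rw [elaplacian_eq_sum_pd]
  simp [pd_pd_norm_sub_sq, mul_comm]

theorem ContDiffAt.eventually_differentiableAt {f : EuclideanSpace ℝ (Fin n) → ℝ}
    {x : EuclideanSpace ℝ (Fin n)} {k : ℕ} (hf : ContDiffAt ℝ k f x) (hk : 1 ≤ k) :
    ∀ᶠ y in 𝓝 x, DifferentiableAt ℝ f y :=
  (hf.eventually (by simp)).mono fun y hy => hy.differentiableAt (by
    have : k ≠ 0 := by omega
    exact_mod_cast this)

theorem ContDiffAt.differentiableAt_pd {f : EuclideanSpace ℝ (Fin n) → ℝ}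
    {x : EuclideanSpace ℝ (Fin n)} (hf : ContDiffAt ℝ 2 f x) (i : Fin n) :
    DifferentiableAt ℝ (_root_.pd i f) x :=
  (ContDiffAt.pd (k := 1) hf (by norm_num) i).differentiableAt (by norm_num)

theorem pd_pd_add {f g : EuclideanSpace ℝ (Fin n) → ℝ} {x : EuclideanSpace ℝ (Fin n)}
    (hf : ContDiffAt ℝ 2 f x) (hg : ContDiffAt ℝ 2 g x) (i j : Fin n) :
    pd i (pd j (fun y => f y + g y)) x = pd i (pd j f) x + pd i (pd j g) x := by
  have h : pd j (fun y => f y + g y) =ᶠ[𝓝 x] fun y => pd j f y + pd j g y := by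
    filter_upwards [ContDiffAt.eventually_differentiableAt (k := 2) hf (by norm_num),
      ContDiffAt.eventually_differentiableAt (k := 2) hg (by norm_num)] with y h1 h2
      using pd_add h1 h2 j
  rw [(h.pd i).eq_of_nhds, pd_add (hf.differentiableAt_pd j) (hg.differentiableAt_pd j)]

theorem pd_pd_const_mul {f : EuclideanSpace ℝ (Fin n) → ℝ} {x : EuclideanSpace ℝ (Fin n)}
    (c : ℝ) (hf : ContDiffAt ℝ 2 f x) (i j : Fin n) :
    pd i (pd j (fun y => c * f y)) x = c * pd i (pd j f) x := by
  have h : pd j (fun y => c * f y) =ᶠ[𝓝 x] fun y => c * pd j f y := by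
    filter_upwards [ContDiffAt.eventually_differentiableAt (k := 2) hf (by norm_num)] with y h1
      using pd_const_mul c h1 j
  rw [(h.pd i).eq_of_nhds, pd_const_mul c (hf.differentiableAt_pd j)]

theorem elaplacian_add {f g : EuclideanSpace ℝ (Fin n) → ℝ} {x : EuclideanSpace ℝ (Fin n)}
    (hf : ContDiffAt ℝ 2 f x) (hg : ContDiffAt ℝ 2 g x) :
    elaplacian (fun y => f y + g y) x = elaplacian f x + elaplacian g x := by
  simp only [elaplacian_eq_sum_pd, pd_pd_add hf hg, Finset.sum_add_distrib]

theorem elaplacian_const_mul {f : EuclideanSpace ℝ (Fin n) → ℝ} {x : EuclideanSpace ℝ (Fin n)}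
    (c : ℝ) (hf : ContDiffAt ℝ 2 f x) :
    elaplacian (fun y => c * f y) x = c * elaplacian f x := by
  simp only [elaplacian_eq_sum_pd, pd_pd_const_mul c hf, Finset.mul_sum]

theorem elaplacian_sub {f g : EuclideanSpace ℝ (Fin n) → ℝ} {x : EuclideanSpace ℝ (Fin n)}
    (hf : ContDiffAt ℝ 2 f x) (hg : ContDiffAt ℝ 2 g x) :
    elaplacian (fun y => f y - g y) x = elaplacian f x - elaplacian g x := by
  have h := elaplacian_add hf (g := fun y => -1 * g y) (contDiffAt_const.mul hg)
  rw [elaplacian_const_mul _ hg] at h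
  simpa [sub_eq_add_neg] using h

/-- Second derivatives of a composition `φ ∘ f`. -/
theorem pd_pd_comp {φ φ' : ℝ → ℝ} {φ'' : ℝ} {f : EuclideanSpace ℝ (Fin n) → ℝ}
    {x : EuclideanSpace ℝ (Fin n)} (hφ : ∀ᶠ t in 𝓝 (f x), HasDerivAt φ (φ' t) t)
    (hφ' : HasDerivAt φ' φ'' (f x)) (hf : ContDiffAt ℝ 2 f x) (i j : Fin n) :
    pd i (pd j (fun y => φ (f y))) x =
      φ'' * pd i f x * pd j f x + φ' (f x) * pd i (pd j f) x := by
  have h : pd j (fun y => φ (f y)) =ᶠ[𝓝 x] fun y => φ' (f y) * pd j f y := by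
    filter_upwards [hf.continuousAt.eventually hφ,
      ContDiffAt.eventually_differentiableAt (k := 2) hf (by norm_num)] with y h1 h2
      using pd_comp h1 h2 j
  have hd : DifferentiableAt ℝ f x := hf.differentiableAt (by norm_num)
  have hc : DifferentiableAt ℝ (fun y => φ' (f y)) x := hφ'.differentiableAt.comp x hd
  rw [(h.pd i).eq_of_nhds, pd_mul hc (hf.differentiableAt_pd j), pd_comp hφ' hd]

theorem pd_sum_pd_sq {v : EuclideanSpace ℝ (Fin n) → ℝ} {x : EuclideanSpace ℝ (Fin n)}
    (hv : ContDiffAt ℝ 2 v x) (i : Fin n) :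
    pd i (fun y => ∑ j, pd j v y ^ 2) x = 2 * ∑ j, pd j v x * pd i (pd j v) x := by
  rw [pd_sum (fun j _ => (hv.differentiableAt_pd j).fun_pow 2), Finset.mul_sum]
  refine Finset.sum_congr rfl fun j _ => ?_
  rw [pd_sq (hv.differentiableAt_pd j)]; ring

/-- Bochner's formula in `ℝⁿ`. -/
theorem elaplacian_sum_pd_sq {W : EuclideanSpace ℝ (Fin n) → ℝ} (hW : ContDiff ℝ 3 W)
    (x : EuclideanSpace ℝ (Fin n)) :
    elaplacian (fun y => ∑ j, pd j W y ^ 2) x =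
      2 * ∑ i, ∑ j, pd i (pd j W) x ^ 2 + 2 * ∑ j, pd j W x * pd j (elaplacian W) x := by
  have hW2 : ContDiff ℝ 2 W := hW.of_le (by norm_num)
  have h1 : ∀ j, ContDiff ℝ 2 (pd j W) := fun j => ContDiff.pd (k := 2) hW (by norm_num) j
  have h2 : ∀ i j, ContDiff ℝ 1 (pd i (pd j W)) := fun i j =>
    ContDiff.pd (k := 1) (l := 2) (h1 j) (by norm_num) i
  have d1 : ∀ j y, DifferentiableAt ℝ (pd j W) y := fun j y =>
    (h1 j).contDiffAt.differentiableAt (by norm_num)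
  have d2 : ∀ i j y, DifferentiableAt ℝ (pd i (pd j W)) y := fun i j y =>
    (h2 i j).contDiffAt.differentiableAt (by norm_num)
  have key : ∀ i, pd i (pd i (fun y => ∑ j, pd j W y ^ 2)) x =
      2 * ∑ j, (pd i (pd j W) x ^ 2 + pd j W x * pd j (pd i (pd i W)) x) := by
    intro i
    rw [show pd i (fun y => ∑ j, pd j W y ^ 2) =
      fun y => 2 * ∑ j, pd j W y * pd i (pd j W) y from
        funext fun y => pd_sum_pd_sq hW2.contDiffAt i,
      pd_const_mul _ (DifferentiableAt.fun_sum fun j _ => (d1 j x).fun_mul (d2 i j x)),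
      pd_sum (fun j _ => (d1 j x).fun_mul (d2 i j x))]
    congr 1
    refine Finset.sum_congr rfl fun j _ => ?_
    rw [pd_mul (d1 j x) (d2 i j x), sq, pd_pd_comm (h1 i).contDiffAt j i,
      show pd i (pd j W) = pd j (pd i W) from
        funext fun y => pd_pd_comm hW2.contDiffAt i j]
  rw [elaplacian_eq_sum_pd, Finset.sum_congr rfl fun i _ => key i, ← Finset.mul_sum,
    ← mul_add]
  congr 1
  simp only [Finset.sum_add_distrib]
  congr 1
  rw [Finset.sum_comm]
  refine Finset.sum_congr rfl fun j _ => ?_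
  rw [elaplacian_eq_sum_pd_fun, pd_sum (fun i _ => d2 i i x), Finset.mul_sum]

theorem abs_sq_sub_sq_le {a b K δ : ℝ} (h : |a - b| ≤ δ) (hb : |b| ≤ K) (hδ : δ ≤ 1) :
    |a ^ 2 - b ^ 2| ≤ (2 * K + 1) * δ := by
  have h1 : |a + b| ≤ 2 * K + 1 := by
    calc |a + b| = |(a - b) + 2 * b| := by ring_nf
      _ ≤ |a - b| + |2 * b| := abs_add_le _ _
      _ ≤ 2 * K + 1 := by rw [abs_mul, abs_two]; linarith
  rw [sq_sub_sq, abs_mul]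
  exact mul_le_mul h1 h (abs_nonneg _) ((abs_nonneg _).trans h1)

theorem abs_mul_sub_mul_le {a b c d K δ : ℝ} (h : |a - b| ≤ δ) (h' : |c - d| ≤ δ) (hb : |b| ≤ K)
    (hd : |d| ≤ K) (hδ : δ ≤ 1) : |a * c - b * d| ≤ (2 * K + 1) * δ := by
  have hδ0 : 0 ≤ δ := (abs_nonneg _).trans h
  have e : a * c - b * d = (a - b) * (c - d) + (a - b) * d + b * (c - d) := by ring
  have h1 : |(a - b) * (c - d)| ≤ δ := by
    rw [abs_mul]; nlinarith [abs_nonneg (a - b), abs_nonneg (c - d)]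
  have h2 : |(a - b) * d| ≤ δ * K := by
    rw [abs_mul]; exact mul_le_mul h hd (abs_nonneg _) hδ0
  have h3 : |b * (c - d)| ≤ K * δ := by
    rw [abs_mul]; exact mul_le_mul hb h' (abs_nonneg _) ((abs_nonneg _).trans hb)
  rw [e]
  linarith [abs_add_le ((a - b) * (c - d) + (a - b) * d) (b * (c - d)),
    abs_add_le ((a - b) * (c - d)) ((a - b) * d)]

theorem abs_sum_sub_sum_le {ι : Type*} [Fintype ι] {f g : ι → ℝ} {ε : ℝ}
    (h : ∀ i, |f i - g i| ≤ ε) : |∑ i, f i - ∑ i, g i| ≤ Fintype.card ι * ε := by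
  rw [← Finset.sum_sub_distrib]
  refine (Finset.abs_sum_le_sum_abs _ _).trans ((Finset.sum_le_sum fun i _ => h i).trans ?_)
  simp

/-- A function which is `C^k` at a point agrees near that point with a compactly supported
`C^k` function. -/
theorem exists_contDiff_hasCompactSupport_eventuallyEq {f : EuclideanSpace ℝ (Fin n) → ℝ}
    {x : EuclideanSpace ℝ (Fin n)} {k : ℕ} (hf : ContDiffAt ℝ k f x) :
    ∃ g, ContDiff ℝ k g ∧ HasCompactSupport g ∧ g =ᶠ[𝓝 x] f := by
  obtain ⟨ε, hε, h⟩ := Metric.eventually_nhds_iff_ball.1 (hf.eventually (by simp))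
  let χ : ContDiffBump x := ⟨ε / 4, ε / 2, by linarith, by linarith⟩
  refine ⟨fun y => χ y * f y, contDiff_iff_contDiffAt.2 fun y => ?_,
    χ.hasCompactSupport.mul_right, ?_⟩
  · by_cases hy : y ∈ ball x ε
    · exact χ.contDiffAt.mul (h y hy)
    · have hy' : y ∈ (closedBall x (ε / 2))ᶜ := fun hc =>
        hy (mem_ball.2 (lt_of_le_of_lt (mem_closedBall.1 hc) (by linarith)))
      refine (contDiffAt_const (c := 0)).congr_of_eventuallyEq ?_
      filter_upwards [isClosed_closedBall.isOpen_compl.mem_nhds hy'] with z hz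
      have hz' : ε / 2 < dist z x := by simpa using hz
      have : χ z = 0 := χ.zero_of_le_dist hz'.le
      simp [this]
  · filter_upwards [χ.eventuallyEq_one] with y hy
    simp [hy]

theorem HasCompactSupport.exists_abs_le {g : EuclideanSpace ℝ (Fin n) → ℝ}
    (hc : HasCompactSupport g) (hg : Continuous g) :
    ∀ᶠ K in atTop, ∀ x, |g x| ≤ K := by
  obtain ⟨C, hC⟩ := hc.exists_bound_of_continuous hg
  filter_upwards [eventually_ge_atTop C] with K hK x using (hC x).trans hK

theorem bochner_le_of_isLocalMax_aux {V G Ψ : EuclideanSpace ℝ (Fin n) → ℝ}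
    (hV : ContDiff ℝ 2 V) (hVc : HasCompactSupport V) (hG : ContDiff ℝ 1 G)
    (hGc : HasCompactSupport G) (hΨ : ContDiff ℝ 2 Ψ) {x : EuclideanSpace ℝ (Fin n)}
    (hVG : elaplacian V =ᶠ[𝓝 x] G)
    (hmax : IsLocalMax (fun y => ∑ i, pd i V y ^ 2 - Ψ y) x) :
    2 * ∑ i, ∑ j, pd i (pd j V) x ^ 2 + 2 * ∑ j, pd j V x * pd j G x - elaplacian Ψ x ≤ 0 := by
  have hV1 : ∀ i, ContDiff ℝ 1 (pd i V) := fun i => ContDiff.pd (k := 1) hV (by norm_num) i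
  have hV1c := fun i => (hV1 i).continuous
  have hV2 : ∀ i j, Continuous (pd i (pd j V)) := fun i j =>
    (ContDiff.pd (k := 0) (l := 1) (hV1 j) (by norm_num) i).continuous
  have hG1 : ∀ i, Continuous (pd i G) := fun i =>
    (ContDiff.pd (k := 0) (l := 1) hG (by norm_num) i).continuous
  have hΨ2 : Continuous (elaplacian Ψ) := by
    refine continuous_finsetSum _ fun i _ => ?_
    have h1 : ContDiff ℝ 1 (pd i Ψ) := ContDiff.pd (k := 1) hΨ (by norm_num) i
    exact (ContDiff.pd (k := 0) (l := 1) h1 (by norm_num) i).continuous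
  set D : EuclideanSpace ℝ (Fin n) → ℝ := fun y =>
    2 * ∑ i, ∑ j, pd i (pd j V) y ^ 2 + 2 * ∑ j, pd j V y * pd j G y - elaplacian Ψ y with hD
  have hDc : Continuous D := by fun_prop
  by_contra! hpos
  change 0 < D x at hpos
  obtain ⟨r, hr, hball⟩ := Metric.eventually_nhds_iff_ball.1
    (hVG.and (hmax.and (hDc.continuousAt.eventually (lt_mem_nhds (half_lt_self hpos)))))
  obtain ⟨K, k1, k2, k3, hK⟩ := ((eventually_all.2 fun i => (hVc.pd i).exists_abs_le (hV1c i)).and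
    ((eventually_all.2 fun i => eventually_all.2 fun j =>
      ((hVc.pd j).pd i).exists_abs_le (hV2 i j)).and
    ((eventually_all.2 fun i => (hGc.pd i).exists_abs_le (hG1 i)).and
      (eventually_ge_atTop (0 : ℝ))))).exists
  set ρ := r / 4 with hρ
  have hρ0 : 0 < ρ := by positivity
  set c := D x / (8 * (n + 1)) with hc
  have hc0 : 0 < c := by positivity
  have hcn : 2 * n * c < D x / 4 := by
    rw [hc]
    have : 2 * (n : ℝ) * (D x / (8 * (n + 1))) = D x / 4 * (n / (n + 1)) := by
      field_simp; ring
    rw [this]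
    exact mul_lt_of_lt_one_right (by positivity) ((div_lt_one (by positivity)).2 (by linarith))
  obtain ⟨δ, hδ0, hδ1, hδA, hδB⟩ : ∃ δ > 0, δ ≤ 1 ∧ 2 * (n * ((2 * K + 1) * δ)) < c * ρ ^ 2 ∧
      2 * (n * (n * ((2 * K + 1) * δ))) + 2 * (n * ((2 * K + 1) * δ)) < D x / 4 := by
    have t1 : Tendsto (fun δ : ℝ => 2 * (n * ((2 * K + 1) * δ))) (𝓝[>] 0) (𝓝 0) :=
      tendsto_nhdsWithin_of_tendsto_nhds
        ((by fun_prop : Continuous fun δ : ℝ => 2 * (n * ((2 * K + 1) * δ))).tendsto' _ _ (by simp))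
    have t2 : Tendsto (fun δ : ℝ => 2 * (n * (n * ((2 * K + 1) * δ))) + 2 * (n * ((2 * K + 1) * δ)))
        (𝓝[>] 0) (𝓝 0) :=
      tendsto_nhdsWithin_of_tendsto_nhds
        ((by fun_prop : Continuous fun δ : ℝ =>
          2 * (n * (n * ((2 * K + 1) * δ))) + 2 * (n * ((2 * K + 1) * δ))).tendsto' _ _ (by simp))
    obtain ⟨δ, a, b, h0, h1⟩ := ((t1.eventually (gt_mem_nhds (by positivity : 0 < c * ρ ^ 2))).and
      ((t2.eventually (gt_mem_nhds (by positivity : 0 < D x / 4))).and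
        (Ioo_mem_nhdsGT (zero_lt_one' ℝ)))).exists
    exact ⟨δ, h0, h1.le, a, b⟩
  obtain ⟨W, hW, w1, w2, w3⟩ := exists_smooth_approx (x := x) (r := r / 2) hV hVc hG hGc
    (by positivity) (fun y hy => (hball y (by convert hy using 2; ring)).1) hδ0
  set F : EuclideanSpace ℝ (Fin n) → ℝ := fun y => ∑ i, pd i V y ^ 2 - Ψ y with hF
  set F' : EuclideanSpace ℝ (Fin n) → ℝ := fun y => ∑ i, pd i W y ^ 2 - Ψ y with hF'
  have hFF : ∀ y, |F' y - F y| ≤ n * ((2 * K + 1) * δ) := fun y => by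
    have := abs_sum_sub_sum_le fun i => abs_sq_sub_sq_le (w1 i y) (k1 i y) hδ1
    simpa [hF, hF'] using this
  have hW1 : ∀ i, ContDiff ℝ 2 (pd i W) := fun i => ContDiff.pd (k := 2) hW (by norm_num) i
  have hS2 : ContDiff ℝ 2 fun y => ∑ i, pd i W y ^ 2 :=
    ContDiff.sum fun i _ => (hW1 i).pow 2
  have hF'2 : ContDiff ℝ 2 F' := hS2.sub hΨ
  have hq2 : ContDiff ℝ 2 (fun y => ‖y - x‖ ^ 2) := contDiff_norm_sub_sq x 2
  set H : EuclideanSpace ℝ (Fin n) → ℝ := fun y => F' y - c * ‖y - x‖ ^ 2 with hH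
  have hH2 : ContDiff ℝ 2 H := hF'2.sub (contDiff_const.mul hq2)
  obtain ⟨y, hy, hymax⟩ := (isCompact_closedBall x ρ).exists_isMaxOn
    ⟨x, mem_closedBall_self hρ0.le⟩ hH2.continuous.continuousOn
  have hyr : y ∈ ball x (r / 2) := mem_ball.2 (lt_of_le_of_lt (mem_closedBall.1 hy) (by
    rw [hρ]; linarith))
  have hyr' : y ∈ ball x r := ball_subset_ball (by linarith) hyr
  have hyin : y ∈ ball x ρ := by
    by_contra hny
    have hd : ‖y - x‖ = ρ := by
      rw [← dist_eq_norm]; exact le_antisymm hy (not_lt.1 hny)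
    have h1 : H x ≤ H y := hymax (mem_closedBall_self hρ0.le)
    have h2 : F y ≤ F x := (hball y hyr').2.1
    have h3 := abs_le.1 (hFF x)
    have h4 := abs_le.1 (hFF y)
    simp only [hH, hd, sub_self, norm_zero] at h1
    norm_num at h1
    linarith [h3.1, h4.2]
  have hloc : IsLocalMax H y :=
    hymax.isLocalMax (mem_of_superset (isOpen_ball.mem_nhds hyin) ball_subset_closedBall)
  have hle := hloc.elaplacian_nonpos hH2.contDiffAt
  rw [hH, elaplacian_sub hF'2.contDiffAt (contDiff_const.mul hq2).contDiffAt,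
    elaplacian_const_mul _ hq2.contDiffAt, elaplacian_norm_sub_sq, hF',
    elaplacian_sub hS2.contDiffAt hΨ.contDiffAt, elaplacian_sum_pd_sq hW] at hle
  have hDy : D x / 2 < D y := (hball y hyr').2.2
  have e1 := abs_sum_sub_sum_le fun i => abs_sum_sub_sum_le fun j =>
    abs_sq_sub_sq_le (w2 i j y) (k2 i j y) hδ1
  have e2 := abs_sum_sub_sum_le fun j =>
    abs_mul_sub_mul_le (w1 j y) (w3 j y hyr) (k1 j y) (k3 j y) hδ1
  simp only [Fintype.card_fin] at e1 e2
  simp only [hD] at hDy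
  linarith [(abs_le.1 e1).1, (abs_le.1 e2).1]

/-- Maximum principle for `|∇v|² - ψ` where `v` is only `C²` but its Laplacian is `C¹`: the
inequality `Δ(|∇v|² - ψ) ≤ 0` holds at a local maximum with the left-hand side computed
by Bochner's formula. -/
theorem bochner_le_of_isLocalMax {v ψ : EuclideanSpace ℝ (Fin n) → ℝ}
    {x : EuclideanSpace ℝ (Fin n)} (hv : ContDiffAt ℝ 2 v x)
    (hΔ : ContDiffAt ℝ 1 (elaplacian v) x) (hψ : ContDiffAt ℝ 2 ψ x)
    (hmax : IsLocalMax (fun y => ∑ i, pd i v y ^ 2 - ψ y) x) :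
    2 * ∑ i, ∑ j, pd i (pd j v) x ^ 2 + 2 * ∑ j, pd j v x * pd j (elaplacian v) x -
      elaplacian ψ x ≤ 0 := by
  obtain ⟨V, hV, hVc, hVv⟩ := exists_contDiff_hasCompactSupport_eventuallyEq (k := 2) hv
  obtain ⟨G, hG, hGc, hGv⟩ := exists_contDiff_hasCompactSupport_eventuallyEq (k := 1) hΔ
  obtain ⟨Ψ, hΨ, -, hΨψ⟩ := exists_contDiff_hasCompactSupport_eventuallyEq (k := 2) hψ
  have hVG : elaplacian V =ᶠ[𝓝 x] G := by
    filter_upwards [hVv.eventuallyEq_nhds, hGv] with y h1 h2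
    rw [h1.elaplacian_eq, h2]
  have hmax' : IsLocalMax (fun y => ∑ i, pd i V y ^ 2 - Ψ y) x := by
    refine hmax.congr ?_
    filter_upwards [eventually_all.2 fun i => hVv.pd i, hΨψ] with y h1 h2
    simp [h1, h2]
  have h := bochner_le_of_isLocalMax_aux hV hVc hG hGc hΨ hVG hmax'
  simp only [fun i => (hVv.pd i).eq_of_nhds, fun i j => ((hVv.pd j).pd i).eq_of_nhds,
    fun i => (hGv.pd i).eq_of_nhds, hΨψ.elaplacian_eq] at h
  exact h

end LocalMaximum

section MaximumPoint

variable {n : ℕ}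

/-- The squared norm of the gradient, in coordinates. -/
noncomputable def gradSq (v : EuclideanSpace ℝ (Fin n) → ℝ) (x : EuclideanSpace ℝ (Fin n)) : ℝ :=
  ∑ i, pd i v x ^ 2

theorem gradSq_nonneg (v : EuclideanSpace ℝ (Fin n) → ℝ) (x : EuclideanSpace ℝ (Fin n)) :
    0 ≤ gradSq v x :=
  Finset.sum_nonneg fun _ _ => sq_nonneg _

theorem ContDiffAt.gradSq {v : EuclideanSpace ℝ (Fin n) → ℝ} {x : EuclideanSpace ℝ (Fin n)}
    (hv : ContDiffAt ℝ 2 v x) : ContDiffAt ℝ 1 (gradSq v) x :=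
  ContDiffAt.sum fun i _ => (ContDiffAt.pd (k := 1) hv (by norm_num) i).pow 2

/-- A trace inequality for matrices with prescribed quadratic form value in one direction. -/
theorem sq_add_sq_div_le_sum_sq (hn : 2 ≤ n) (M : Fin n → Fin n → ℝ) (g : Fin n → ℝ) {a : ℝ}
    (hg : 0 < ∑ i, g i ^ 2) (ha : ∑ i, g i * ∑ j, g j * M i j = a * ∑ i, g i ^ 2) :
    a ^ 2 + (∑ i, M i i - a) ^ 2 / ((n : ℝ) - 1) ≤ ∑ i, ∑ j, M i j ^ 2 := by
  have hn1 : (0 : ℝ) < n - 1 := by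
    have : (2 : ℝ) ≤ n := by exact_mod_cast hn
    linarith
  set H := ∑ i, g i ^ 2 with hH
  set t := ∑ i, M i i with ht
  set b := (t - a) / (n - 1) with hb
  have hbt : b * (n - 1) = t - a := by rw [hb]; field_simp
  set α := (a - b) / H with hα
  have hαH : α * H = a - b := by rw [hα]; field_simp
  have key : ∑ i, ∑ j, (M i j - (α * (g i * g j) + b * if i = j then 1 else 0)) ^ 2 =
      ∑ i, ∑ j, M i j ^ 2 - 2 * α * (∑ i, g i * ∑ j, g j * M i j) - 2 * b * t
        + α ^ 2 * (H * H) + 2 * α * b * H + b ^ 2 * n := by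
    have e : ∀ i j, (M i j - (α * (g i * g j) + b * if i = j then 1 else 0)) ^ 2 =
        M i j ^ 2 - 2 * α * (g i * (g j * M i j)) + α ^ 2 * (g i ^ 2 * g j ^ 2)
        + (if i = j then -2 * b * M i j + 2 * α * b * (g i * g j) + b ^ 2 else 0) := by
      intro i j; split_ifs <;> ring
    have e2 : H * H = ∑ i, ∑ j, g i ^ 2 * g j ^ 2 := by rw [hH, Finset.sum_mul_sum]
    simp only [e, Finset.sum_add_distrib, Finset.sum_sub_distrib, Finset.sum_ite_eq,
      Finset.mem_univ, if_true, ← Finset.mul_sum, e2]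
    rw [← ht, show ∑ i, g i * g i = H by simp [hH, sq]]
    simp
    ring
  have hnn : 0 ≤ ∑ i, ∑ j, (M i j - (α * (g i * g j) + b * if i = j then 1 else 0)) ^ 2 :=
    Finset.sum_nonneg fun i _ => Finset.sum_nonneg fun j _ => sq_nonneg _
  rw [key, ha] at hnn
  have e3 : (t - a) ^ 2 / ((n : ℝ) - 1) = b ^ 2 * (n - 1) := by
    rw [← hbt]; field_simp
  rw [e3]
  have e4 : 2 * α * (a * H) = 2 * a * (a - b) := by rw [← hαH]; ring
  have e5 : α ^ 2 * (H * H) = (a - b) ^ 2 := by rw [← hαH]; ring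
  have e6 : 2 * α * b * H = 2 * b * (a - b) := by rw [← hαH]; ring
  have e7 : 2 * b * t = 2 * b * (a + b * (n - 1)) := by rw [hbt]; ring
  rw [e4, e5, e6, e7] at hnn
  nlinarith [hnn]

/-- The first and second order conditions at a local maximum of `|∇v|² e^w`. -/
theorem isLocalMax_gradSq_mul_exp (hn : 2 ≤ n) {v w : EuclideanSpace ℝ (Fin n) → ℝ}
    {x : EuclideanSpace ℝ (Fin n)} (hv : ContDiffAt ℝ 2 v x) (hw : ContDiffAt ℝ 2 w x)
    (hΔ : ContDiffAt ℝ 1 (elaplacian v) x) (hpos : 0 < gradSq v x)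
    (hmax : IsLocalMax (fun y => gradSq v y * Real.exp (w y)) x) :
    (∀ j, pd j (gradSq v) x = -gradSq v x * pd j w x) ∧
      (∑ i, pd i w x * pd i v x) ^ 2 / 4 +
        (elaplacian v x + (∑ i, pd i w x * pd i v x) / 2) ^ 2 / ((n : ℝ) - 1) +
        ∑ j, pd j v x * pd j (elaplacian v) x - gradSq v x / 2 * (gradSq w x - elaplacian w x)
        ≤ 0 := by
  set H := gradSq v x with hH
  set φ : ℝ → ℝ := fun t => H * Real.exp (w x - t) with hφ
  set φ' : ℝ → ℝ := fun t => -H * Real.exp (w x - t) with hφ'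
  have dexp : ∀ t, HasDerivAt (fun t => Real.exp (w x - t)) (-Real.exp (w x - t)) t := fun t => by
    simpa using ((hasDerivAt_id t).const_sub (w x)).exp
  have hφd : ∀ t, HasDerivAt φ (φ' t) t := fun t => by
    simpa [hφ'] using (dexp t).const_mul H
  have hφ'd : HasDerivAt φ' H (w x) := by
    have h := (dexp (w x)).const_mul (-H)
    rwa [sub_self, Real.exp_zero, neg_mul_neg, mul_one] at h
  have hφ'x : φ' (w x) = -H := by simp [hφ']
  have hφc : ContDiff ℝ 2 φ := contDiff_const.mul (contDiff_const.sub contDiff_id).exp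
  have hψ : ContDiffAt ℝ 2 (fun y => φ (w y)) x := hφc.contDiffAt.comp x hw
  have hloc : IsLocalMax (fun y => ∑ i, pd i v y ^ 2 - φ (w y)) x := by
    filter_upwards [hmax] with y hy
    have h1 : gradSq v y ≤ φ (w y) := by
      have h2 : gradSq v y * Real.exp (w y) ≤ φ (w y) * Real.exp (w y) := by
        rw [hφ, mul_assoc, ← Real.exp_add, sub_add_cancel]; exact hy
      exact le_of_mul_le_mul_right h2 (Real.exp_pos _)
    have h3 : φ (w x) = gradSq v x := by simp [hφ, hH]
    rw [h3]
    simp only [gradSq] at h1 ⊢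
    linarith
  have hwd : DifferentiableAt ℝ w x := hw.differentiableAt (by norm_num)
  have hSd : DifferentiableAt ℝ (gradSq v) x := hv.gradSq.differentiableAt (by norm_num)
  have hfirst : ∀ j, pd j (gradSq v) x = -H * pd j w x := by
    intro j
    have h1 : pd j (fun y => gradSq v y - φ (w y)) x = 0 := by
      have := hloc.fderiv_eq_zero
      simp only [pd, gradSq] at this ⊢
      rw [this]; simp
    rw [pd_sub hSd (hψ.differentiableAt (by norm_num)), pd_comp (hφd _) hwd, hφ'x] at h1
    linarith
  refine ⟨hfirst, ?_⟩
  have hB := bochner_le_of_isLocalMax hv hΔ hψ hloc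
  have hlapψ : elaplacian (fun y => φ (w y)) x = H * (gradSq w x - elaplacian w x) := by
    rw [elaplacian_eq_sum_pd, gradSq, elaplacian_eq_sum_pd, ← Finset.sum_sub_distrib,
      Finset.mul_sum]
    refine Finset.sum_congr rfl fun i _ => ?_
    rw [pd_pd_comp (Eventually.of_forall hφd) hφ'd hw, hφ'x]; ring
  rw [hlapψ] at hB
  set Y := ∑ i, pd i w x * pd i v x with hY
  have hM : ∑ i, pd i v x * ∑ j, pd j v x * pd i (pd j v) x =
      (-Y / 2) * ∑ i, pd i v x ^ 2 := by
    have e : ∀ i, ∑ j, pd j v x * pd i (pd j v) x = -(H / 2) * pd i w x := fun i => by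
      have h1 := hfirst i
      rw [show gradSq v = fun y => ∑ j, pd j v y ^ 2 from rfl, pd_sum_pd_sq hv] at h1
      linarith
    simp only [e]
    rw [show ∑ i, pd i v x ^ 2 = H from rfl, hY, neg_div, Finset.sum_div, ← Finset.sum_neg_distrib,
      Finset.sum_mul]
    exact Finset.sum_congr rfl fun i _ => by ring
  have hmat := sq_add_sq_div_le_sum_sq hn (fun i j => pd i (pd j v) x) (fun i => pd i v x) hpos hM
  rw [show ∑ i, pd i (pd i v) x = elaplacian v x from rfl] at hmat
  have e1 : (-Y / 2) ^ 2 = Y ^ 2 / 4 := by ring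
  have e2 : elaplacian v x - -Y / 2 = elaplacian v x + Y / 2 := by ring
  rw [e1, e2] at hmat
  linarith

/-- The inequality satisfied at a local maximum of `|∇v|² e^w` when
`Δv = -(|∇v|² + |∇v|^q e^{mv})`. -/
theorem isLocalMax_inequality (hn : 2 ≤ n) {v w : EuclideanSpace ℝ (Fin n) → ℝ} {q m : ℝ}
    {x : EuclideanSpace ℝ (Fin n)} (hv : ContDiffAt ℝ 2 v x) (hw : ContDiffAt ℝ 2 w x)
    (heq : ∀ᶠ y in 𝓝 x, elaplacian v y =
      -(gradSq v y + gradSq v y ^ (q / 2) * Real.exp (m * v y)))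
    (hpos : 0 < gradSq v x)
    (hmax : IsLocalMax (fun y => gradSq v y * Real.exp (w y)) x) {H h Y : ℝ}
    (hH : H = gradSq v x) (hh : h = gradSq v x ^ (q / 2) * Real.exp (m * v x))
    (hY : Y = ∑ i, pd i w x * pd i v x) :
    Y ^ 2 / 4 + (H + h - Y / 2) ^ 2 / ((n : ℝ) - 1) + H * Y + q / 2 * h * Y - m * h * H -
      H / 2 * (gradSq w x - elaplacian w x) ≤ 0 := by
  have hSc := hv.gradSq
  have hSd : DifferentiableAt ℝ (gradSq v) x := hSc.differentiableAt (by norm_num)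
  have hvd : DifferentiableAt ℝ v x := hv.differentiableAt (by norm_num)
  have hPc : ContDiffAt ℝ 1 (fun y => gradSq v y ^ (q / 2)) x :=
    hSc.rpow_const_of_ne hpos.ne'
  have hEc : ContDiffAt ℝ 1 (fun y => Real.exp (m * v y)) x :=
    (contDiffAt_const.mul (hv.of_le (by norm_num))).exp
  have hPd := hPc.differentiableAt one_ne_zero
  have hEd := hEc.differentiableAt one_ne_zero
  have heq' : elaplacian v =ᶠ[𝓝 x] fun y =>
      -1 * (gradSq v y + gradSq v y ^ (q / 2) * Real.exp (m * v y)) :=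
    heq.mono fun y hy => by rw [hy]; ring
  have hΔ : ContDiffAt ℝ 1 (elaplacian v) x :=
    (contDiffAt_const.mul (hSc.add (hPc.mul hEc))).congr_of_eventuallyEq heq'
  obtain ⟨hfirst, hsecond⟩ := isLocalMax_gradSq_mul_exp hn hv hw hΔ hpos hmax
  have hpd : ∀ j, pd j (elaplacian v) x =
      H * pd j w x + q / 2 * h * pd j w x - m * h * pd j v x := by
    intro j
    have hpow : HasDerivAt (fun t : ℝ => t ^ (q / 2)) (q / 2 * gradSq v x ^ (q / 2 - 1))
        (gradSq v x) := Real.hasDerivAt_rpow_const (Or.inl hpos.ne')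
    have hexp : HasDerivAt (fun t : ℝ => Real.exp (m * t)) (Real.exp (m * v x) * m) (v x) := by
      simpa using ((hasDerivAt_id (v x)).const_mul m).exp
    rw [(heq'.pd j).eq_of_nhds, pd_const_mul _ (hSd.fun_add (hPd.fun_mul hEd)),
      pd_add hSd (hPd.fun_mul hEd), pd_mul hPd hEd, pd_comp hpow hSd, pd_comp hexp hvd, hfirst,
      Real.rpow_sub_one hpos.ne', hh, hH]
    field_simp
    ring
  have hsum : ∑ j, pd j v x * pd j (elaplacian v) x = H * Y + q / 2 * h * Y - m * h * H := by
    simp only [hpd]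
    have e : ∀ j, pd j v x * (H * pd j w x + q / 2 * h * pd j w x - m * h * pd j v x) =
        (H + q / 2 * h) * (pd j w x * pd j v x) - m * h * pd j v x ^ 2 := fun j => by ring
    simp only [e, Finset.sum_sub_distrib, ← Finset.mul_sum]
    rw [← hY, show ∑ i, pd i v x ^ 2 = H from hH.symm]
    ring
  have e0 : elaplacian v x = -(H + h) := by rw [heq.self_of_nhds, hH, hh]
  rw [hsum, e0, ← hY, ← hH] at hsecond
  have e1 : (-(H + h) + Y / 2) ^ 2 = (H + h - Y / 2) ^ 2 := by ring
  rw [e1] at hsecond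
  linarith

/-- The cutoff `1 - |y - x₀|²/ρ²`. -/
noncomputable def cutoff (x₀ : EuclideanSpace ℝ (Fin n)) (ρ : ℝ)
    (y : EuclideanSpace ℝ (Fin n)) : ℝ :=
  1 - (1 / ρ ^ 2) * ‖y - x₀‖ ^ 2

theorem contDiff_cutoff (x₀ : EuclideanSpace ℝ (Fin n)) (ρ : ℝ) : ContDiff ℝ 2 (cutoff x₀ ρ) :=
  contDiff_const.sub (contDiff_const.mul (contDiff_norm_sub_sq x₀ 2))

theorem cutoff_le_one (x₀ : EuclideanSpace ℝ (Fin n)) (ρ : ℝ) (y : EuclideanSpace ℝ (Fin n)) :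
    cutoff x₀ ρ y ≤ 1 :=
  sub_le_self _ (by positivity)

theorem cutoff_pos {x₀ : EuclideanSpace ℝ (Fin n)} {ρ : ℝ} {y : EuclideanSpace ℝ (Fin n)}
    (hy : y ∈ ball x₀ ρ) : 0 < cutoff x₀ ρ y := by
  have h1 : ‖y - x₀‖ < ρ := by simpa [dist_eq_norm] using hy
  have h0 : 0 < ρ := (norm_nonneg _).trans_lt h1
  have h2 : ‖y - x₀‖ ^ 2 < ρ ^ 2 := by gcongr
  rw [cutoff, one_div_mul_eq_div, sub_pos, div_lt_one (by positivity)]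
  exact h2

theorem pd_cutoff (x₀ : EuclideanSpace ℝ (Fin n)) (ρ : ℝ) (y : EuclideanSpace ℝ (Fin n))
    (i : Fin n) : pd i (cutoff x₀ ρ) y = -(1 / ρ ^ 2) * (2 * (y i - x₀ i)) := by
  have hd := ((contDiff_norm_sub_sq x₀ 1).differentiable (by norm_num)) y
  unfold cutoff
  rw [pd_sub (differentiableAt_const _) (hd.const_mul _), pd_const, pd_const_mul _ hd,
    pd_norm_sub_sq]
  ring

theorem elaplacian_cutoff (x₀ : EuclideanSpace ℝ (Fin n)) (ρ : ℝ)
    (y : EuclideanSpace ℝ (Fin n)) : elaplacian (cutoff x₀ ρ) y = -(1 / ρ ^ 2) * (2 * n) := by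
  have hd := (contDiff_norm_sub_sq x₀ 2).contDiffAt (x := y)
  unfold cutoff
  rw [elaplacian_sub contDiffAt_const (contDiffAt_const.mul hd), elaplacian_const_mul _ hd,
    elaplacian_norm_sub_sq, elaplacian_eq_sum_pd]
  have : ∀ i : Fin n, pd i (fun _ : EuclideanSpace ℝ (Fin n) => (1 : ℝ)) = fun _ => 0 :=
    fun i => funext fun z => pd_const 1 i z
  simp [this, pd_const]

/-- Bounds for the derivatives of the logarithm of the cutoff. -/
theorem log_cutoff_bounds {x₀ : EuclideanSpace ℝ (Fin n)} {ρ : ℝ} {x : EuclideanSpace ℝ (Fin n)}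
    (hx : x ∈ ball x₀ ρ) :
    ContDiffAt ℝ 2 (fun y => Real.log (cutoff x₀ ρ y)) x ∧
    gradSq (fun y => Real.log (cutoff x₀ ρ y)) x ≤ (2 / (ρ * cutoff x₀ ρ x)) ^ 2 ∧
    ∃ T, 0 ≤ T ∧ T ≤ n / 2 * (2 / (ρ * cutoff x₀ ρ x)) ^ 2 ∧
      elaplacian (fun y => Real.log (cutoff x₀ ρ y)) x =
        -gradSq (fun y => Real.log (cutoff x₀ ρ y)) x - T := by
  have hpos := cutoff_pos hx
  have hle := cutoff_le_one x₀ ρ x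
  have h1 : ‖x - x₀‖ < ρ := by simpa [dist_eq_norm] using hx
  have hρ : 0 < ρ := (norm_nonneg _).trans_lt h1
  have hc : ContDiffAt ℝ 2 (cutoff x₀ ρ) x := (contDiff_cutoff x₀ ρ).contDiffAt
  have hcd : DifferentiableAt ℝ (cutoff x₀ ρ) x := hc.differentiableAt (by norm_num)
  have hlog : ∀ᶠ t in 𝓝 (cutoff x₀ ρ x), HasDerivAt Real.log t⁻¹ t :=
    (lt_mem_nhds hpos).mono fun t ht => Real.hasDerivAt_log ht.ne'
  have hinv : HasDerivAt (fun t : ℝ => t⁻¹) (-(cutoff x₀ ρ x ^ 2)⁻¹) (cutoff x₀ ρ x) :=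
    hasDerivAt_inv hpos.ne'
  set c := cutoff x₀ ρ x
  have hpd : ∀ i, pd i (fun y => Real.log (cutoff x₀ ρ y)) x = c⁻¹ * pd i (cutoff x₀ ρ) x :=
    fun i => pd_comp hlog.self_of_nhds hcd i
  have hgrad : gradSq (fun y => Real.log (cutoff x₀ ρ y)) x =
      (2 / (ρ ^ 2 * c)) ^ 2 * ‖x - x₀‖ ^ 2 := by
    rw [gradSq, EuclideanSpace.norm_sq_eq, Finset.mul_sum]
    refine Finset.sum_congr rfl fun i _ => ?_
    rw [hpd, pd_cutoff]
    simp only [PiLp.sub_apply, Real.norm_eq_abs, sq_abs]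
    field_simp
  refine ⟨hc.log hpos.ne', ?_, 1 / ρ ^ 2 * (2 * n) / c, by positivity, ?_, ?_⟩
  · rw [hgrad]
    have : ‖x - x₀‖ ^ 2 ≤ ρ ^ 2 := by gcongr
    calc (2 / (ρ ^ 2 * c)) ^ 2 * ‖x - x₀‖ ^ 2 ≤ (2 / (ρ ^ 2 * c)) ^ 2 * ρ ^ 2 := by gcongr
      _ = _ := by field_simp
  · have e : (n : ℝ) / 2 * (2 / (ρ * c)) ^ 2 = 1 / ρ ^ 2 * (2 * n) / (c * c) := by
      field_simp
    rw [e]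
    gcongr
    nlinarith
  · rw [elaplacian_eq_sum_pd]
    have e : ∀ i, pd i (pd i (fun y => Real.log (cutoff x₀ ρ y))) x =
        -pd i (fun y => Real.log (cutoff x₀ ρ y)) x ^ 2 + c⁻¹ * pd i (pd i (cutoff x₀ ρ)) x := by
      intro i
      rw [pd_pd_comp hlog hinv hc, hpd]
      ring
    simp only [e, Finset.sum_add_distrib, Finset.sum_neg_distrib, ← Finset.mul_sum]
    rw [← elaplacian_eq_sum_pd, elaplacian_cutoff, gradSq]
    ring

/-- The inequality at a local maximum of `|∇v|² e^{sv} η^k`, with `η` the cutoff, in terms of real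
numbers only. -/
theorem isLocalMax_cutoff_inequality (hn : 2 ≤ n) {v : EuclideanSpace ℝ (Fin n) → ℝ} {q m : ℝ}
    {x₀ x : EuclideanSpace ℝ (Fin n)} {ρ s k : ℝ} (hx : x ∈ ball x₀ ρ) (hv : ContDiffAt ℝ 2 v x)
    (heq : ∀ᶠ y in 𝓝 x, elaplacian v y =
      -(gradSq v y + gradSq v y ^ (q / 2) * Real.exp (m * v y)))
    (hpos : 0 < gradSq v x)
    (hmax : IsLocalMax (fun y => gradSq v y *
      Real.exp (s * v y + k * Real.log (cutoff x₀ ρ y))) x) {H h β : ℝ}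
    (hH : H = gradSq v x) (hh : h = gradSq v x ^ (q / 2) * Real.exp (m * v x))
    (hβ : β = 2 / (ρ * cutoff x₀ ρ x)) :
    ∃ y B T : ℝ, y ^ 2 ≤ β ^ 2 * H ∧ 0 ≤ B ∧ B ≤ β ^ 2 ∧ 0 ≤ T ∧ T ≤ n / 2 * β ^ 2 ∧
      (s * H + k * y) ^ 2 / 4 + (H + h - (s * H + k * y) / 2) ^ 2 / ((n : ℝ) - 1)
        + H * (s * H + k * y) + q / 2 * h * (s * H + k * y) - m * h * H
        - H / 2 * (s ^ 2 * H + 2 * s * k * y + k ^ 2 * B + s * (H + h) + k * B + k * T) ≤ 0 := by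
  obtain ⟨hΛ, hB, T, hT0, hT, hlap⟩ := log_cutoff_bounds hx
  rw [← hβ] at hB hT
  set Λ : EuclideanSpace ℝ (Fin n) → ℝ := fun y => Real.log (cutoff x₀ ρ y)
  set B := gradSq Λ x with hBdef
  set y := ∑ i, pd i Λ x * pd i v x with hy
  have hvd : DifferentiableAt ℝ v x := hv.differentiableAt (by norm_num)
  have hΛd : DifferentiableAt ℝ Λ x := hΛ.differentiableAt (by norm_num)
  have hsv : ContDiffAt ℝ 2 (fun y => s * v y) x := contDiffAt_const.mul hv
  have hkΛ : ContDiffAt ℝ 2 (fun y => k * Λ y) x := contDiffAt_const.mul hΛ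
  have hpd : ∀ i, pd i (fun y => s * v y + k * Λ y) x = s * pd i v x + k * pd i Λ x := fun i => by
    rw [pd_add (hvd.const_mul s) (hΛd.const_mul k), pd_const_mul s hvd, pd_const_mul k hΛd]
  have hlapw : elaplacian (fun y => s * v y + k * Λ y) x = -s * (H + h) + k * (-B - T) := by
    rw [elaplacian_add hsv hkΛ, elaplacian_const_mul s hv, elaplacian_const_mul k hΛ,
      heq.self_of_nhds, hlap, hH, hh]
    ring
  have hY : s * H + k * y = ∑ i, pd i (fun y => s * v y + k * Λ y) x * pd i v x := by
    simp only [hpd, add_mul, Finset.sum_add_distrib, hy, hH, gradSq, Finset.mul_sum]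
    congr 1 <;> exact Finset.sum_congr rfl fun i _ => by ring
  have hW : gradSq (fun y => s * v y + k * Λ y) x = s ^ 2 * H + 2 * s * k * y + k ^ 2 * B := by
    simp only [gradSq, hpd, hy, hH, hBdef, Finset.mul_sum, ← Finset.sum_add_distrib]
    exact Finset.sum_congr rfl fun i _ => by ring
  refine ⟨y, B, T, ?_, gradSq_nonneg _ _, hB, hT0, hT, ?_⟩
  · have hcs : y ^ 2 ≤ B * H := by
      rw [hH]; exact Finset.sum_mul_sq_le_sq_mul_sq _ _ _
    have hH0 : 0 ≤ H := hH ▸ hpos.le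
    exact hcs.trans (by gcongr)
  · have hmain := isLocalMax_inequality hn hv (hsv.add hkΛ) heq hpos hmax hH hh hY
    rw [hW, hlapw] at hmain
    linarith

end MaximumPoint

section Estimates

/-- Coercivity: the inequality at the maximum of `|∇v|² η²` bounds `|∇v|²`. -/
theorem le_of_max_inequality_gradient {ν q m N₀ : ℝ} (hν : 0 < ν) (hq : 0 ≤ q) (hN₀ : 0 ≤ N₀)
    (hm : m < 4 / ν) : ∃ C > 0, ∀ H h β y B T : ℝ, 0 < H → 0 ≤ h → 0 ≤ β → y ^ 2 ≤ β ^ 2 * H →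
      0 ≤ B → B ≤ β ^ 2 → 0 ≤ T → T ≤ N₀ * β ^ 2 →
      (0 * H + 2 * y) ^ 2 / 4 + (H + h - (0 * H + 2 * y) / 2) ^ 2 / ν
        + H * (0 * H + 2 * y) + q / 2 * h * (0 * H + 2 * y) - m * h * H
        - H / 2 * (0 ^ 2 * H + 2 * 0 * 2 * y + 2 ^ 2 * B + 0 * (H + h) + 2 * B + 2 * T) ≤ 0 →
      H ≤ C * β ^ 2 := by
  obtain ⟨c, hc0, hc1, hc2⟩ : ∃ c > 0, c ≤ 1 / ν ∧ m / 4 ≤ 1 / ν - c := by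
    refine ⟨min (1 / ν) (1 / ν - m / 4), lt_min (by positivity) ?_, min_le_left _ _, ?_⟩
    · have : 4 / ν = 4 * (1 / ν) := by ring
      linarith
    · linarith [min_le_right (1 / ν) (1 / ν - m / 4)]
  set K := 2 / ν + 2 + q with hK
  set K' := 3 + N₀ with hK'
  have hK0 : 0 < K := by positivity
  have hK'0 : 0 < K' := by positivity
  refine ⟨K ^ 2 / c ^ 2 + 2 * K' / c, by positivity, ?_⟩
  intro H h β y B T hH hh hβ hy hB0 hB hT0 hT hmain
  obtain ⟨z, hz, rfl⟩ : ∃ z > 0, H = z ^ 2 := ⟨√H, Real.sqrt_pos.2 hH, (Real.sq_sqrt hH.le).symm⟩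
  set N := z ^ 2 + h with hN
  have hN0 : 0 < N := by positivity
  have hyz : |y| ≤ β * z := abs_le_of_sq_le_sq (by rw [mul_pow]; exact hy) (by positivity)
  have hcoer : c * N ^ 2 ≤ N ^ 2 / ν - m * h * z ^ 2 := by
    have h1 : z ^ 2 * h ≤ N ^ 2 / 4 := by nlinarith [sq_nonneg (z ^ 2 - h)]
    have h0 : 0 ≤ z ^ 2 * h := by positivity
    have h2 : m / 4 * (4 * (z ^ 2 * h)) ≤ (1 / ν - c) * (4 * (z ^ 2 * h)) := by gcongr
    have h3 : (1 / ν - c) * (4 * (z ^ 2 * h)) ≤ (1 / ν - c) * N ^ 2 := by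
      have : 0 ≤ 1 / ν - c := by linarith
      gcongr
      linarith
    have e : N ^ 2 / ν = 1 / ν * N ^ 2 := by ring
    rw [e]; linarith
  have hexp : (N - y) ^ 2 / ν = N ^ 2 / ν - 2 / ν * (N * y) + y ^ 2 / ν := by ring
  have hNy : N * y ≤ N * (β * z) := by gcongr; exact (le_abs_self y).trans hyz
  have hny : -y ≤ β * z := (neg_le_abs y).trans hyz
  have hzy : -(z ^ 2 * y) ≤ N * (β * z) := by
    have h1 : z ^ 2 * -y ≤ z ^ 2 * (β * z) := by gcongr
    have h2 : z ^ 2 * (β * z) ≤ N * (β * z) := by gcongr; linarith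
    linarith
  have hhy : -(h * y) ≤ N * (β * z) := by
    have h1 : h * -y ≤ h * (β * z) := by gcongr
    have h2 : h * (β * z) ≤ N * (β * z) := by gcongr; linarith [sq_nonneg z]
    linarith
  have hlow : z ^ 2 * (3 * B + T) ≤ N * (K' * β ^ 2) := by
    gcongr
    · linarith
    · rw [hK']; linarith
  have hsum : N * (c * N) ≤ N * (K * (β * z) + K' * β ^ 2) := by
    have e1 : 2 / ν * (N * y) ≤ 2 / ν * (N * (β * z)) := by gcongr
    have e2 : q * -(h * y) ≤ q * (N * (β * z)) := by gcongr
    have e3 : 0 ≤ y ^ 2 / ν := by positivity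
    have e4 : (z ^ 2 + h - (0 * z ^ 2 + 2 * y) / 2) ^ 2 / ν = (N - y) ^ 2 / ν := by
      rw [hN]; ring
    rw [e4, hexp] at hmain
    rw [hK]
    nlinarith [sq_nonneg y]
  have hN1 := le_of_mul_le_mul_left hsum hN0
  have hz2 : c * z ^ 2 ≤ K * (β * z) + K' * β ^ 2 :=
    (mul_le_mul_of_nonneg_left (by linarith : z ^ 2 ≤ N) hc0.le).trans hN1
  have hyoung : K * (β * z) ≤ c * z ^ 2 / 2 + K ^ 2 * β ^ 2 / (2 * c) := by
    have : c * z ^ 2 / 2 + K ^ 2 * β ^ 2 / (2 * c) - K * (β * z) =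
        (c * z - K * β) ^ 2 / (2 * c) := by field_simp; ring
    have h2 : 0 ≤ (c * z - K * β) ^ 2 / (2 * c) := by positivity
    linarith
  have hfin : c * z ^ 2 ≤ K ^ 2 * β ^ 2 / c + 2 * K' * β ^ 2 := by
    have : K ^ 2 * β ^ 2 / (2 * c) = K ^ 2 * β ^ 2 / c / 2 := by field_simp
    linarith
  have : z ^ 2 ≤ (K ^ 2 * β ^ 2 / c + 2 * K' * β ^ 2) / c := by
    rw [le_div_iff₀ hc0]; linarith
  refine this.trans (le_of_eq ?_)
  field_simp

/-- Once `|∇v|²` is bounded, the inequality at the maximum of `|∇v|² e^{sv} η^k` bounds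
`h = |∇v|^q e^{mv}`. -/
theorem le_of_max_inequality_source {ν q m N₀ s k A : ℝ} (hν : 0 < ν) (hN₀ : 0 ≤ N₀)
    (hk : 0 ≤ k) (hA : 0 ≤ A) : ∃ C > 0, ∀ H h β y B T : ℝ, 0 < H → 0 ≤ h → 0 ≤ β →
      H ≤ A * β ^ 2 → y ^ 2 ≤ β ^ 2 * H → 0 ≤ B → B ≤ β ^ 2 → 0 ≤ T → T ≤ N₀ * β ^ 2 →
      (s * H + k * y) ^ 2 / 4 + (H + h - (s * H + k * y) / 2) ^ 2 / ν
        + H * (s * H + k * y) + q / 2 * h * (s * H + k * y) - m * h * H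
        - H / 2 * (s ^ 2 * H + 2 * s * k * y + k ^ 2 * B + s * (H + h) + k * B + k * T) ≤ 0 →
      h ≤ C * β ^ 2 := by
  obtain ⟨K₁, hK₁⟩ : ∃ K₁, K₁ = |s| * A + k * (1 + A) := ⟨_, rfl⟩
  obtain ⟨K₂, hK₂⟩ : ∃ K₂, K₂ = s ^ 2 * A + 2 * |s| * k * (1 + A) + k ^ 2 + |s| * A + k +
    k * N₀ := ⟨_, rfl⟩
  obtain ⟨P, hP⟩ : ∃ P, P = (A + K₁) ^ 2 / ν + A * K₁ + A * K₂ := ⟨_, rfl⟩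
  obtain ⟨Q, hQ⟩ : ∃ Q, Q = |q| * K₁ + |m| * A + A * |s| := ⟨_, rfl⟩
  have hK₁0 : 0 ≤ K₁ := by rw [hK₁]; positivity
  have hK₂0 : 0 ≤ K₂ := by rw [hK₂]; positivity
  have hP0 : 0 ≤ P := by rw [hP]; positivity
  have hQ0 : 0 ≤ Q := by rw [hQ]; positivity
  refine ⟨1 + 2 * ν * (P + Q), by positivity, ?_⟩
  intro H h β y B T hH hh hβ hHA hy hB0 hB hT0 hT hmain
  obtain ⟨E, hE⟩ : ∃ E, E = β ^ 2 := ⟨_, rfl⟩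
  rw [← hE] at hHA hy hB hT ⊢
  have hE0 : 0 ≤ E := hE ▸ sq_nonneg β
  have hy1 : |y| ≤ (1 + A) * E := by
    refine abs_le_of_sq_le_sq (hy.trans ?_) (by positivity)
    calc E * H ≤ E * (A * E) := by gcongr
      _ ≤ ((1 + A) * E) ^ 2 := by nlinarith [mul_nonneg hA hE0, sq_nonneg E, sq_nonneg (A * E)]
  obtain ⟨Y, hY⟩ : ∃ Y, Y = s * H + k * y := ⟨_, rfl⟩
  rw [← hY] at hmain
  have hYb : |Y| ≤ K₁ * E := by
    calc |Y| ≤ |s * H| + |k * y| := hY ▸ abs_add_le _ _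
      _ = |s| * H + k * |y| := by rw [abs_mul, abs_mul, abs_of_pos hH, abs_of_nonneg hk]
      _ ≤ |s| * (A * E) + k * ((1 + A) * E) := by gcongr
      _ = K₁ * E := by rw [hK₁]; ring
  have hHY : |H * Y| ≤ A * K₁ * E ^ 2 := by
    rw [abs_mul, abs_of_pos hH]
    calc H * |Y| ≤ (A * E) * (K₁ * E) := by gcongr
      _ = _ := by ring
  have hqY : |q / 2 * h * Y| ≤ |q| * K₁ * (h * E) := by
    rw [abs_mul, abs_mul, abs_of_nonneg hh, abs_div, abs_two]
    calc |q| / 2 * h * |Y| ≤ |q| * h * (K₁ * E) := by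
          gcongr; linarith [abs_nonneg q]
      _ = _ := by ring
  have hmH : m * h * H ≤ |m| * A * (h * E) := by
    calc m * h * H ≤ |m| * h * (A * E) := by gcongr; exact le_abs_self m
      _ = _ := by ring
  have hsq : h ^ 2 / (2 * ν) - (A + K₁) ^ 2 / ν * E ^ 2 ≤ (H + h - Y / 2) ^ 2 / ν := by
    have h1 : |H - Y / 2| ≤ (A + K₁) * E := by
      calc |H - Y / 2| ≤ |H| + |Y / 2| := abs_sub _ _
        _ ≤ A * E + K₁ * E := by
          rw [abs_of_pos hH, abs_div, abs_two]
          linarith [abs_nonneg Y]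
        _ = _ := by ring
    have h2 : (H - Y / 2) ^ 2 ≤ ((A + K₁) * E) ^ 2 := sq_le_sq' (abs_le.1 h1).1 (abs_le.1 h1).2
    have h3 : h ^ 2 / 2 - (A + K₁) ^ 2 * E ^ 2 ≤ (H + h - Y / 2) ^ 2 := by
      have e : (H + h - Y / 2) ^ 2 =
          h ^ 2 / 2 - (H - Y / 2) ^ 2 + (h + 2 * (H - Y / 2)) ^ 2 / 2 := by ring
      have h4 := sq_nonneg (h + 2 * (H - Y / 2))
      rw [mul_pow] at h2
      linarith
    calc h ^ 2 / (2 * ν) - (A + K₁) ^ 2 / ν * E ^ 2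
        = (h ^ 2 / 2 - (A + K₁) ^ 2 * E ^ 2) / ν := by field_simp
      _ ≤ _ := by gcongr
  have hlast : H / 2 * (s ^ 2 * H + 2 * s * k * y + k ^ 2 * B + s * (H + h) + k * B + k * T) ≤
      A * K₂ * E ^ 2 + A * |s| * (h * E) := by
    have h1 : s ^ 2 * H + 2 * s * k * y + k ^ 2 * B + s * (H + h) + k * B + k * T ≤
        K₂ * E + |s| * h := by
      have a1 : s ^ 2 * H ≤ s ^ 2 * (A * E) := by gcongr
      have a2 : 2 * s * k * y ≤ 2 * |s| * k * ((1 + A) * E) := by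
        calc 2 * s * k * y ≤ |2 * s * k * y| := le_abs_self _
          _ = 2 * |s| * k * |y| := by
            rw [abs_mul, abs_mul, abs_mul, abs_two, abs_of_nonneg hk]
          _ ≤ _ := by gcongr
      have a3 : k ^ 2 * B ≤ k ^ 2 * E := by gcongr
      have a4 : s * (H + h) ≤ |s| * (A * E + h) := by gcongr; exact le_abs_self s
      have a5 : k * B ≤ k * E := by gcongr
      have a6 : k * T ≤ k * (N₀ * E) := by gcongr
      rw [hK₂]; linarith
    calc H / 2 * (s ^ 2 * H + 2 * s * k * y + k ^ 2 * B + s * (H + h) + k * B + k * T)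
        ≤ H / 2 * (K₂ * E + |s| * h) := by gcongr
      _ ≤ (A * E) * (K₂ * E + |s| * h) := by gcongr; linarith
      _ = _ := by ring
  have hquad : h ^ 2 / (2 * ν) ≤ P * E ^ 2 + Q * (h * E) := by
    rw [hP, hQ]
    linarith [(abs_le.1 hHY).1, (abs_le.1 hqY).1, sq_nonneg Y]
  by_contra! hlt
  have hC1 : E ≤ h := by
    have : E ≤ (1 + 2 * ν * (P + Q)) * E :=
      le_mul_of_one_le_left hE0 (by linarith [show 0 ≤ 2 * ν * (P + Q) by positivity])
    linarith
  have hh0 : 0 < h := lt_of_le_of_lt (by positivity) hlt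
  have h1 : P * E ^ 2 ≤ P * (h * E) := by rw [sq]; gcongr
  have h2 : h * h ≤ h * (2 * ν * (P + Q) * E) := by
    have h3 : h ^ 2 / (2 * ν) ≤ (P + Q) * (h * E) := by linarith
    rw [div_le_iff₀ (by positivity)] at h3
    linarith
  have h4 := le_of_mul_le_mul_left h2 hh0
  linarith

variable {n : ℕ}

theorem le_cutoff {x₀ x : EuclideanSpace ℝ (Fin n)} {ρ t : ℝ} (hρ : 0 < ρ)
    (hx : x ∈ ball x₀ (t * ρ)) : 1 - t ^ 2 ≤ cutoff x₀ ρ x := by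
  have h1 : ‖x - x₀‖ < t * ρ := by simpa [dist_eq_norm] using hx
  have h2 : ‖x - x₀‖ ^ 2 ≤ (t * ρ) ^ 2 := by gcongr
  rw [cutoff, one_div_mul_eq_div]
  have : ‖x - x₀‖ ^ 2 / ρ ^ 2 ≤ t ^ 2 := by
    rw [div_le_iff₀ (by positivity), ← mul_pow]; exact h2
  linarith

theorem exists_isLocalMax_cutoff {v : EuclideanSpace ℝ (Fin n) → ℝ}
    {x₀ x₁ : EuclideanSpace ℝ (Fin n)} {ρ ρ' k : ℝ} (s : ℝ) (hρ : ρ < ρ') (hk : 0 < k)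
    (hv : ∀ x ∈ ball x₀ ρ', ContDiffAt ℝ 2 v x) (hx₁ : x₁ ∈ ball x₀ ρ)
    (hpos : 0 < gradSq v x₁) :
    ∃ x ∈ ball x₀ ρ, 0 < gradSq v x ∧
      IsLocalMax (fun y => gradSq v y *
        Real.exp (s * v y + k * Real.log (cutoff x₀ ρ y))) x ∧
      gradSq v x₁ * Real.exp (s * v x₁) * cutoff x₀ ρ x₁ ^ k ≤
        gradSq v x * Real.exp (s * v x) * cutoff x₀ ρ x ^ k := by
  set Φ : EuclideanSpace ℝ (Fin n) → ℝ := fun x =>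
    gradSq v x * Real.exp (s * v x) * cutoff x₀ ρ x ^ k with hΦ
  have hρ0 : 0 < ρ := pos_of_mem_ball hx₁
  have hcont : ContinuousOn Φ (closedBall x₀ ρ) := fun x hx => by
    have hvx := hv x (closedBall_subset_ball hρ hx)
    have h1 : ContinuousAt (gradSq v) x := hvx.gradSq.continuousAt
    have h2 : ContinuousAt v x := hvx.continuousAt
    have h3 : ContinuousAt (cutoff x₀ ρ) x := (contDiff_cutoff x₀ ρ).continuous.continuousAt
    exact ((h1.mul (by fun_prop)).mul (h3.rpow_const (Or.inr hk.le))).continuousWithinAt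
  obtain ⟨x, hx, hmax⟩ := (isCompact_closedBall x₀ ρ).exists_isMaxOn
    ⟨x₁, ball_subset_closedBall hx₁⟩ hcont
  have hle : Φ x₁ ≤ Φ x := hmax (ball_subset_closedBall hx₁)
  have hΦ₁ : 0 < Φ x₁ :=
    mul_pos (mul_pos hpos (Real.exp_pos _)) (Real.rpow_pos_of_pos (cutoff_pos hx₁) _)
  have hΦx : Φ x ≠ 0 := (hΦ₁.trans_le hle).ne'
  have hxin : x ∈ ball x₀ ρ := by
    by_contra hnx
    have hd : ‖x - x₀‖ = ρ := by
      rw [← dist_eq_norm]; exact le_antisymm hx (not_lt.1 hnx)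
    have hc : cutoff x₀ ρ x = 0 := by
      rw [cutoff, hd]; field_simp; simp
    exact hΦx (by simp [hΦ, hc, Real.zero_rpow hk.ne'])
  have hgpos : 0 < gradSq v x :=
    lt_of_le_of_ne (gradSq_nonneg v x) fun h => hΦx (by simp [hΦ, ← h])
  refine ⟨x, hxin, hgpos, ?_, hle⟩
  have hrew : ∀ y ∈ ball x₀ ρ,
      gradSq v y * Real.exp (s * v y + k * Real.log (cutoff x₀ ρ y)) = Φ y := fun y hy => by
    rw [Real.exp_add, mul_comm k, ← Real.rpow_def_of_pos (cutoff_pos hy)]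
    exact (mul_assoc _ _ _).symm
  filter_upwards [isOpen_ball.mem_nhds hxin] with y hy
  rw [hrew y hy, hrew x hxin]
  exact hmax (ball_subset_closedBall hy)

theorem exists_gradSq_bound (hn : 2 ≤ n) {q m : ℝ} (hq : 0 ≤ q) (hm : m < 4 / ((n : ℝ) - 1)) :
    ∃ A > 0, ∀ (x₀ : EuclideanSpace ℝ (Fin n)) (ρ ρ' : ℝ) (v : EuclideanSpace ℝ (Fin n) → ℝ),
      ρ < ρ' → (∀ x ∈ ball x₀ ρ', ContDiffAt ℝ 2 v x) →
      (∀ x ∈ ball x₀ ρ', elaplacian v x =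
        -(gradSq v x + gradSq v x ^ (q / 2) * Real.exp (m * v x))) →
      ∀ x ∈ ball x₀ ρ, gradSq v x * cutoff x₀ ρ x ^ 2 ≤ A / ρ ^ 2 := by
  have hν : (0 : ℝ) < n - 1 := by
    have : (2 : ℝ) ≤ n := by exact_mod_cast hn
    linarith
  obtain ⟨C, hC, hCH⟩ := le_of_max_inequality_gradient (N₀ := n / 2) hν hq (by positivity) hm
  refine ⟨4 * C, by positivity, fun x₀ ρ ρ' v hρ hv heq x₁ hx₁ => ?_⟩
  have hρ0 : 0 < ρ := pos_of_mem_ball hx₁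
  rcases (gradSq_nonneg v x₁).eq_or_lt with h0 | hpos
  · rw [← h0, zero_mul]; positivity
  obtain ⟨x, hx, hgx, hmax, hle⟩ := exists_isLocalMax_cutoff 0 hρ (k := 2) two_pos hv hx₁ hpos
  have hx' : x ∈ ball x₀ ρ' := ball_subset_ball hρ.le hx
  obtain ⟨y, B, T, hy, hB0, hB, hT0, hT, hmain⟩ := isLocalMax_cutoff_inequality hn hx (hv x hx')
    (by filter_upwards [isOpen_ball.mem_nhds hx'] using heq) hgx hmax rfl rfl rfl
  have hη := cutoff_pos hx
  have hH := hCH _ _ _ y B T hgx (by positivity) (by positivity) hy hB0 hB hT0 hT hmain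
  simp only [zero_mul, Real.exp_zero, mul_one, Real.rpow_two] at hle
  refine hle.trans ?_
  calc gradSq v x * cutoff x₀ ρ x ^ 2
      ≤ C * (2 / (ρ * cutoff x₀ ρ x)) ^ 2 * cutoff x₀ ρ x ^ 2 := by gcongr
    _ = 4 * C / ρ ^ 2 := by field_simp; norm_num

theorem exists_source_bound_of_pos (hn : 2 ≤ n) {q m A : ℝ} (hq : 0 < q) (hA : 0 < A) :
    ∃ A' > 0, ∀ (x₀ : EuclideanSpace ℝ (Fin n)) (ρ ρ' : ℝ) (v : EuclideanSpace ℝ (Fin n) → ℝ),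
      ρ < ρ' → (∀ x ∈ ball x₀ ρ', ContDiffAt ℝ 2 v x) →
      (∀ x ∈ ball x₀ ρ', elaplacian v x =
        -(gradSq v x + gradSq v x ^ (q / 2) * Real.exp (m * v x))) →
      (∀ x ∈ ball x₀ ρ, gradSq v x ≤ A / ρ ^ 2) →
      ∀ x ∈ ball x₀ ρ, gradSq v x ^ (q / 2) * Real.exp (m * v x) * cutoff x₀ ρ x ^ 2 ≤
        A' / ρ ^ 2 := by
  have hν : (0 : ℝ) < n - 1 := by
    have : (2 : ℝ) ≤ n := by exact_mod_cast hn
    linarith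
  obtain ⟨C, hC, hCH⟩ := le_of_max_inequality_source (q := q) (m := m) (N₀ := n / 2)
    (s := 2 * m / q) (k := 4 / q) hν (by positivity) (by positivity) hA.le
  refine ⟨4 * C, by positivity, fun x₀ ρ ρ' v hρ hv heq hgrad x₁ hx₁ => ?_⟩
  have hρ0 : 0 < ρ := pos_of_mem_ball hx₁
  rcases (gradSq_nonneg v x₁).eq_or_lt with h0 | hpos
  · rw [← h0, Real.zero_rpow (by positivity), zero_mul, zero_mul]; positivity
  obtain ⟨x, hx, hgx, hmax, hle⟩ := exists_isLocalMax_cutoff (2 * m / q) hρ (k := 4 / q)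
    (by positivity) hv hx₁ hpos
  have hx' : x ∈ ball x₀ ρ' := ball_subset_ball hρ.le hx
  obtain ⟨y, B, T, hy, hB0, hB, hT0, hT, hmain⟩ := isLocalMax_cutoff_inequality hn hx (hv x hx')
    (by filter_upwards [isOpen_ball.mem_nhds hx'] using heq) hgx hmax rfl rfl rfl
  have hη := cutoff_pos hx
  have hη1 := cutoff_le_one x₀ ρ x
  have hgβ : gradSq v x ≤ A * (2 / (ρ * cutoff x₀ ρ x)) ^ 2 := by
    refine (hgrad x hx).trans ?_
    have e : A * (2 / (ρ * cutoff x₀ ρ x)) ^ 2 = 4 * A / (ρ ^ 2 * cutoff x₀ ρ x ^ 2) := by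
      field_simp; norm_num
    rw [e]
    gcongr
    · linarith
    · exact mul_le_of_le_one_right (by positivity) (pow_le_one₀ hη.le hη1)
  have hh := hCH _ _ _ y B T hgx (by positivity) (by positivity) hgβ hy hB0 hB hT0 hT hmain
  have hpow : ∀ z ∈ ball x₀ ρ,
      (gradSq v z * Real.exp (2 * m / q * v z) * cutoff x₀ ρ z ^ (4 / q)) ^ (q / 2) =
        gradSq v z ^ (q / 2) * Real.exp (m * v z) * cutoff x₀ ρ z ^ 2 := fun z hz => by
    have hz0 := cutoff_pos hz
    have hg0 := gradSq_nonneg v z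
    rw [Real.mul_rpow (by positivity) (by positivity), Real.mul_rpow hg0 (by positivity),
      ← Real.exp_mul, ← Real.rpow_mul hz0.le,
      show 2 * m / q * v z * (q / 2) = m * v z by field_simp,
      show 4 / q * (q / 2) = ((2 : ℕ) : ℝ) by push_cast; field_simp; norm_num,
      Real.rpow_natCast]
  have hle' := Real.rpow_le_rpow
    (mul_nonneg (mul_nonneg hpos.le (Real.exp_pos _).le)
      (Real.rpow_nonneg (cutoff_pos hx₁).le _)) hle (by positivity : 0 ≤ q / 2)
  rw [hpow x₁ hx₁, hpow x hx] at hle'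
  refine hle'.trans ?_
  calc gradSq v x ^ (q / 2) * Real.exp (m * v x) * cutoff x₀ ρ x ^ 2
      ≤ C * (2 / (ρ * cutoff x₀ ρ x)) ^ 2 * cutoff x₀ ρ x ^ 2 := by gcongr
    _ = 4 * C / ρ ^ 2 := by field_simp; norm_num

theorem norm_fderiv_sq_eq_gradSq (v : EuclideanSpace ℝ (Fin n) → ℝ)
    (x : EuclideanSpace ℝ (Fin n)) : ‖fderiv ℝ v x‖ ^ 2 = gradSq v x := by
  rw [gradSq, ← norm_gradient_sq, gradient, LinearIsometryEquiv.norm_map]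

theorem exists_source_bound_of_exp {m A : ℝ} (hA : 0 < A) :
    ∃ A' > 0, ∀ (x₀ : EuclideanSpace ℝ (Fin n)) (ρ : ℝ) (v : EuclideanSpace ℝ (Fin n) → ℝ),
      (∀ x ∈ ball x₀ ρ, ContDiffAt ℝ 2 v x) →
      (∀ x ∈ ball x₀ ρ, elaplacian v x = -(gradSq v x + Real.exp (m * v x))) →
      (∀ x ∈ ball x₀ ρ, gradSq v x ≤ A / ρ ^ 2) →
      ∀ x ∈ ball x₀ (2 / 3 * ρ), Real.exp (m * v x) ≤ A' / ρ ^ 2 := by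
  set K := 4 * √A + 16 with hK
  have hK0 : 0 < K := by positivity
  refine ⟨2 * (n + 1) * K * Real.exp (|m| * √A), by positivity,
    fun x₀ ρ v hv heq hgrad x₁ hx₁ => ?_⟩
  have hρ0 : 0 < ρ := by linarith [pos_of_mem_ball hx₁]
  have hsub : closedBall x₁ (ρ / 4) ⊆ ball x₀ ρ := fun y hy => by
    have h1 := mem_closedBall.1 hy
    have h2 := mem_ball.1 hx₁
    exact mem_ball.2 (by linarith [dist_triangle y x₁ x₀])
  have hx₁m : x₁ ∈ closedBall x₁ (ρ / 4) := mem_closedBall_self (by positivity)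
  have hlip : ∀ y ∈ closedBall x₁ (ρ / 4), |v y - v x₁| ≤ √A / 4 := fun y hy => by
    have hbound : ∀ z ∈ closedBall x₁ (ρ / 4), ‖fderiv ℝ v z‖ ≤ √A / ρ := fun z hz => by
      refine (sq_le_sq₀ (norm_nonneg _) (by positivity)).1 ?_
      rw [norm_fderiv_sq_eq_gradSq, div_pow, Real.sq_sqrt hA.le]
      exact hgrad z (hsub hz)
    have h := (convex_closedBall x₁ (ρ / 4)).norm_image_sub_le_of_norm_fderiv_le (𝕜 := ℝ)
      (fun z hz => (hv z (hsub hz)).differentiableAt (by norm_num)) hbound hx₁m hy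
    rw [Real.norm_eq_abs, ← dist_eq_norm] at h
    calc |v y - v x₁| ≤ √A / ρ * dist y x₁ := h
      _ ≤ √A / ρ * (ρ / 4) := by gcongr; exact mem_closedBall.1 hy
      _ = √A / 4 := by field_simp
  set f : EuclideanSpace ℝ (Fin n) → ℝ := fun y => -(K / ρ ^ 2) * ‖y - x₁‖ ^ 2 - v y with hf
  have hq2 : ContDiff ℝ 2 (fun y => ‖y - x₁‖ ^ 2) := contDiff_norm_sub_sq x₁ 2
  have hfc : ∀ y ∈ closedBall x₁ (ρ / 4), ContDiffAt ℝ 2 f y := fun y hy =>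
    (contDiffAt_const.mul hq2.contDiffAt).sub (hv y (hsub hy))
  obtain ⟨y, hy, hmax⟩ := (isCompact_closedBall x₁ (ρ / 4)).exists_isMaxOn ⟨x₁, hx₁m⟩
    fun y hy => (hfc y hy).continuousAt.continuousWithinAt
  have hyin : y ∈ ball x₁ (ρ / 4) := by
    by_contra hny
    have hd : ‖y - x₁‖ = ρ / 4 := by
      rw [← dist_eq_norm]; exact le_antisymm hy (not_lt.1 hny)
    have h1 : f x₁ ≤ f y := hmax hx₁m
    have h2 := (abs_le.1 (hlip y hy)).1
    simp only [hf, hd, sub_self, norm_zero] at h1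
    have e : -(K / ρ ^ 2) * (ρ / 4) ^ 2 = -(√A / 4 + 1) := by
      rw [hK]; field_simp; norm_num; ring
    rw [e] at h1
    norm_num at h1
    linarith
  have hyρ := hsub hy
  have hle := (hmax.isLocalMax
    (mem_of_superset (isOpen_ball.mem_nhds hyin) ball_subset_closedBall)).elaplacian_nonpos
      (hfc y hy)
  rw [hf, elaplacian_sub (contDiffAt_const.mul hq2.contDiffAt) (hv y hyρ),
    elaplacian_const_mul _ hq2.contDiffAt, elaplacian_norm_sub_sq, heq y hyρ] at hle
  have hexp : Real.exp (m * v y) ≤ 2 * (n + 1) * K / ρ ^ 2 := by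
    have e : 2 * ((n : ℝ) + 1) * K / ρ ^ 2 = K / ρ ^ 2 * (2 * n) + 2 * K / ρ ^ 2 := by ring
    have : 0 ≤ 2 * K / ρ ^ 2 := by positivity
    rw [e]
    linarith [gradSq_nonneg v y]
  have hdiff : m * (v x₁ - v y) ≤ |m| * √A := by
    calc m * (v x₁ - v y) ≤ |m * (v x₁ - v y)| := le_abs_self _
      _ = |m| * |v y - v x₁| := by rw [abs_mul, abs_sub_comm]
      _ ≤ |m| * √A := by gcongr; linarith [hlip y hy, Real.sqrt_nonneg A]
  calc Real.exp (m * v x₁) = Real.exp (m * v y) * Real.exp (m * (v x₁ - v y)) := by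
        rw [← Real.exp_add]; ring_nf
    _ ≤ 2 * (n + 1) * K / ρ ^ 2 * Real.exp (|m| * √A) := by gcongr
    _ = _ := by ring

/-- The gradient estimate for `v = log u`. -/
theorem exists_log_gradient_bound (hn : 2 ≤ n) {q m : ℝ} (hq : 0 ≤ q)
    (hm : m < 4 / ((n : ℝ) - 1)) :
    ∃ C > 0, ∀ (x₀ : EuclideanSpace ℝ (Fin n)) (R : ℝ) (v : EuclideanSpace ℝ (Fin n) → ℝ),
      (∀ x ∈ ball x₀ (2 * R), ContDiffAt ℝ 2 v x) →
      (∀ x ∈ ball x₀ (2 * R), elaplacian v x =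
        -(gradSq v x + gradSq v x ^ (q / 2) * Real.exp (m * v x))) →
      ∀ x ∈ ball x₀ R, gradSq v x + gradSq v x ^ (q / 2) * Real.exp (m * v x) ≤ C / R ^ 2 := by
  obtain ⟨A₁, hA₁, h₁⟩ := exists_gradSq_bound hn hq hm
  set A := A₁ * (49 / 13) ^ 2 with hA
  have hA0 : 0 < A := by positivity
  obtain ⟨A₂, hA₂, h₂⟩ : ∃ A' > 0, ∀ (x₀ : EuclideanSpace ℝ (Fin n)) (ρ ρ' : ℝ)
      (v : EuclideanSpace ℝ (Fin n) → ℝ), ρ < ρ' →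
      (∀ x ∈ ball x₀ ρ', ContDiffAt ℝ 2 v x) →
      (∀ x ∈ ball x₀ ρ', elaplacian v x =
        -(gradSq v x + gradSq v x ^ (q / 2) * Real.exp (m * v x))) →
      (∀ x ∈ ball x₀ ρ, gradSq v x ≤ A / ρ ^ 2) →
      ∀ x ∈ ball x₀ (2 / 3 * ρ), gradSq v x ^ (q / 2) * Real.exp (m * v x) ≤ A' / ρ ^ 2 := by
    rcases hq.eq_or_lt with rfl | hq
    · obtain ⟨A', hA', h⟩ := exists_source_bound_of_exp (n := n) (m := m) hA0
      refine ⟨A', hA', fun x₀ ρ ρ' v hρ hv heq hgrad x hx => ?_⟩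
      simp only [zero_div, Real.rpow_zero, one_mul] at heq ⊢
      exact h x₀ ρ v (fun y hy => hv y (ball_subset_ball hρ.le hy))
        (fun y hy => heq y (ball_subset_ball hρ.le hy)) hgrad x hx
    · obtain ⟨A', hA', h⟩ := exists_source_bound_of_pos hn (m := m) hq hA0
      refine ⟨A' * (9 / 5) ^ 2, by positivity, fun x₀ ρ ρ' v hρ hv heq hgrad x hx => ?_⟩
      have hρ0 : 0 < ρ := by linarith [pos_of_mem_ball hx]
      have hb := h x₀ ρ ρ' v hρ hv heq hgrad x (ball_subset_ball (by linarith) hx)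
      have hc := le_cutoff hρ0 hx
      have hg := gradSq_nonneg v x
      set a := gradSq v x ^ (q / 2) * Real.exp (m * v x) with ha
      have ha0 : 0 ≤ a := by positivity
      have : a * (5 / 9) ^ 2 ≤ A' / ρ ^ 2 := by
        refine le_trans ?_ hb
        gcongr
        norm_num at hc ⊢
        exact hc
      have e : A' * (9 / 5) ^ 2 / ρ ^ 2 = A' / ρ ^ 2 * (9 / 5) ^ 2 := by ring
      rw [e]
      linarith
  refine ⟨A + A₂, by positivity, fun x₀ R v hv heq x hx => ?_⟩
  have hR : 0 < R := pos_of_mem_ball hx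
  have hgrad : ∀ y ∈ ball x₀ (3 / 2 * R), gradSq v y ≤ A / (3 / 2 * R) ^ 2 := fun y hy => by
    have hc := le_cutoff (t := 6 / 7) (ρ := 7 / 4 * R) (by positivity)
      (by convert hy using 2; ring : y ∈ ball x₀ (6 / 7 * (7 / 4 * R)))
    have hb := h₁ x₀ (7 / 4 * R) (2 * R) v (by linarith) hv heq y
      (ball_subset_ball (by linarith) hy)
    have hg := gradSq_nonneg v y
    have h3 : gradSq v y * (13 / 49) ^ 2 ≤ A₁ / (7 / 4 * R) ^ 2 := by
      refine le_trans ?_ hb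
      gcongr
      norm_num at hc ⊢
      exact hc
    have h4 : A₁ / (7 / 4 * R) ^ 2 ≤ A₁ / (3 / 2 * R) ^ 2 :=
      div_le_div_of_nonneg_left hA₁.le (by positivity)
        (pow_le_pow_left₀ (by positivity) (by linarith) 2)
    have e : A / (3 / 2 * R) ^ 2 = A₁ / (3 / 2 * R) ^ 2 * (49 / 13) ^ 2 := by rw [hA]; ring
    rw [e]
    linarith
  have hsource := h₂ x₀ (3 / 2 * R) (2 * R) v (by linarith) hv heq hgrad x
    (by convert hx using 2; ring)
  have hg := hgrad x (ball_subset_ball (by linarith) hx)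
  have hmono : ∀ a : ℝ, 0 < a → a / (3 / 2 * R) ^ 2 ≤ a / R ^ 2 := fun a ha => by
    gcongr; linarith
  rw [add_div]
  exact add_le_add (hg.trans (hmono A hA0)) (hsource.trans (hmono A₂ hA₂))

end Estimates

section Logarithm

variable {n : ℕ} {u : EuclideanSpace ℝ (Fin n) → ℝ} {x : EuclideanSpace ℝ (Fin n)}

theorem gradSq_log (hu : DifferentiableAt ℝ u x) (hpos : 0 < u x) :
    gradSq (fun y => Real.log (u y)) x = ‖gradient u x‖ ^ 2 / u x ^ 2 := by
  rw [norm_gradient_sq, gradSq, Finset.sum_div]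
  refine Finset.sum_congr rfl fun i _ => ?_
  rw [pd_comp (Real.hasDerivAt_log hpos.ne') hu]
  field_simp

theorem elaplacian_log (hu : ContDiffAt ℝ 2 u x) (hpos : 0 < u x) :
    elaplacian (fun y => Real.log (u y)) x =
      elaplacian u x / u x - ‖gradient u x‖ ^ 2 / u x ^ 2 := by
  have hlog : ∀ᶠ t in 𝓝 (u x), HasDerivAt Real.log t⁻¹ t :=
    (lt_mem_nhds hpos).mono fun t ht => Real.hasDerivAt_log ht.ne'
  rw [norm_gradient_sq, elaplacian_eq_sum_pd, elaplacian_eq_sum_pd, Finset.sum_div,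
    Finset.sum_div, ← Finset.sum_sub_distrib]
  refine Finset.sum_congr rfl fun i _ => ?_
  rw [pd_pd_comp hlog (hasDerivAt_inv hpos.ne') hu]
  field_simp
  ring

theorem gradSq_log_rpow_mul_exp (hu : DifferentiableAt ℝ u x) (hpos : 0 < u x) (p q : ℝ) :
    gradSq (fun y => Real.log (u y)) x ^ (q / 2) * Real.exp ((p + q - 1) * Real.log (u x)) =
      ‖gradient u x‖ ^ q * u x ^ (p - 1) := by
  rw [gradSq_log hu hpos, ← div_pow, ← Real.rpow_natCast, ← Real.rpow_mul (by positivity),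
    mul_comm _ (Real.log _), ← Real.rpow_def_of_pos hpos,
    show ((2 : ℕ) : ℝ) * (q / 2) = q by push_cast; ring,
    Real.div_rpow (norm_nonneg _) hpos.le, show p + q - 1 = (p - 1) + q by ring,
    Real.rpow_add hpos]
  have := (Real.rpow_pos_of_pos hpos q).ne'
  field_simp

end Logarithm

/-- **Theorem 2.2 (Euclidean case).** For `n ≥ 2`, `q ≥ 0` and `p + q < (n+3)/(n−1)`,
there is `C = C(n,p,q) > 0` such that every positive classical solution of
`Δu + |∇u|^q u^p = 0` on `B(x₀, 2R)` satisfies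
`sup_(B(x₀,R)) (|∇u|²/u² + |∇u|^q u^(p−1)) ≤ C / R²`. -/
theorem yau_gradient_estimate (n : ℕ) (hn : 2 ≤ n) (p q : ℝ) (hq : 0 ≤ q)
    (hpq : p + q < ((n : ℝ) + 3) / ((n : ℝ) - 1)) :
    ∃ C > (0 : ℝ), ∀ (x₀ : EuclideanSpace ℝ (Fin n)) (R : ℝ), 0 < R →
      ∀ u : EuclideanSpace ℝ (Fin n) → ℝ,
        ContDiffOn ℝ 2 u (Metric.ball x₀ (2 * R)) →
        (∀ x ∈ Metric.ball x₀ (2 * R), 0 < u x) →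
        (∀ x ∈ Metric.ball x₀ (2 * R),
          elaplacian u x + ‖gradient u x‖ ^ q * u x ^ p = 0) →
        ∀ x ∈ Metric.ball x₀ R,
          ‖gradient u x‖ ^ 2 / u x ^ 2 + ‖gradient u x‖ ^ q * u x ^ (p - 1)
            ≤ C / R ^ 2 := by
  have hν : (0 : ℝ) < n - 1 := by
    have : (2 : ℝ) ≤ n := by exact_mod_cast hn
    linarith
  have hm : p + q - 1 < 4 / ((n : ℝ) - 1) := by
    have : ((n : ℝ) + 3) / ((n : ℝ) - 1) = 4 / ((n : ℝ) - 1) + 1 := by field_simp; ring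
    linarith
  obtain ⟨C, hC, h⟩ := exists_log_gradient_bound hn hq hm
  refine ⟨C, hC, fun x₀ R hR u hu hpos heq x hx => ?_⟩
  have hu' : ∀ y ∈ Metric.ball x₀ (2 * R), ContDiffAt ℝ 2 u y := fun y hy =>
    hu.contDiffAt (Metric.isOpen_ball.mem_nhds hy)
  have hud : ∀ y ∈ Metric.ball x₀ (2 * R), DifferentiableAt ℝ u y := fun y hy =>
    (hu' y hy).differentiableAt (by norm_num)
  have hx' : x ∈ Metric.ball x₀ (2 * R) := Metric.ball_subset_ball (by linarith) hx
  have hb := h x₀ R (fun y => Real.log (u y)) (fun y hy => (hu' y hy).log (hpos y hy).ne')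
    (fun y hy => by
      rw [gradSq_log_rpow_mul_exp (hud y hy) (hpos y hy), gradSq_log (hud y hy) (hpos y hy),
        elaplacian_log (hu' y hy) (hpos y hy), eq_neg_of_add_eq_zero_left (heq y hy),
        Real.rpow_sub_one (hpos y hy).ne']
      ring) x hx
  rwa [gradSq_log_rpow_mul_exp (hud x hx') (hpos x hx'), gradSq_log (hud x hx') (hpos x hx')] at hb
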